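/- arXiv:0805.2882 — 2 statements merged into one kernel-verified Lean document; each statement's English description precedes it below -/
import Mathlib

section
/- Let n ≥ 3, let H₀ = diag(a₁,…,aₙ) be a real diagonal strongly regular n×n matrix, and let H₁ be a fully connected n×n Hermitian matrix with zero diagonal. Let ρ_d(0) be a pseudo-pure density matrix with eigenvalues w (multiplicity 1) and u (multiplicity n−1), w ≠ u, and assume ρ_d(0) is NOT of the exceptional form: there do NOT exist indices k < ℓ and α ∈ ℝ such that ρ_d(0) has (k,k) and (ℓ,ℓ) entries (w+u)/2, (k,ℓ) entry ((w−u)/2)·e^{iα}, (ℓ,k) entry ((w−u)/2)·e^{−iα}, all other diagonal entries u, and all other entries 0. Let ρ, ρ_d : ℝ → Matrix (Fin n) (Fin n) ℂ be differentiable, satisfy ρ'(t) = −i[H₀ + f(t)·H₁, ρ(t)] and ρ_d'(t) = −i[H₀, ρ_d(t)] with f(t) = κ·Re(Tr([−iH₁, ρ(t)]·ρ_d(t))), κ > 0, with ρ(0) unitarily equivalent to ρ_d(0) and ½ Re(Tr((ρ(0) − ρ_d(0))²)) < V_max, where V_max is the maximum of ½ Re(Tr((ρ' − ρ_d(0))²))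 over all ρ' unitarily equivalent to ρ_d(0). Then ρ(t) − ρ_d(t) → 0 as t → +∞. -/
open Matrix Complex
open scoped ComplexOrder

/-- The density matrix of a pure state: an orthogonal projection of trace one. -/
structure IsPureState {ι : Type*} [Fintype ι] (P : Matrix ι ι ℂ) : Prop where
  isHermitian : P.IsHermitian
  mul_self : P * P = P
  trace_eq_one : P.trace = 1

namespace IsPureState

variable {ι : Type*} [Fintype ι] {P Q : Matrix ι ι ℂ}

theorem exists_vec (hP : IsPureState P) :
    ∃ χ : ι → ℂ, (∀ i j, P i j = χ i * star (χ j)) ∧ ∑ i, star (χ i) * χ i = 1 := by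
  have hnorm : ∀ k, ∑ i, star (P i k) * P i k = P k k := fun k => by
    have h := congrFun (congrFun hP.mul_self k) k
    rw [Matrix.mul_apply] at h
    rw [← h]
    refine Finset.sum_congr rfl fun i _ => ?_
    rw [hP.isHermitian.apply]
  obtain ⟨k, hk⟩ : ∃ k, P k k ≠ 0 := by
    by_contra! h
    have h1 := hP.trace_eq_one
    simp [Matrix.trace, h] at h1
  have hreal : ((P k k).re : ℂ) = P k k :=
    Complex.conj_eq_iff_re.1 (hP.isHermitian.apply k k)
  have hpos : 0 < (P k k).re := by
    have h0 : 0 ≤ (P k k).re := by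
      rw [← hnorm k, Complex.re_sum]
      refine Finset.sum_nonneg fun i _ => ?_
      simp only [RCLike.star_def, ← Complex.normSq_eq_conj_mul_self, Complex.ofReal_re]
      exact Complex.normSq_nonneg _
    refine lt_of_le_of_ne h0 fun h => hk ?_
    rw [← hreal, ← h]; simp
  set r : ℂ := ((Real.sqrt (P k k).re : ℝ) : ℂ) with hr
  have hrr : r * r = P k k := by
    rw [hr, ← Complex.ofReal_mul, Real.mul_self_sqrt hpos.le, hreal]
  have hr0 : r ≠ 0 := by rintro h; rw [h] at hrr; exact hk (by simpa using hrr.symm)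
  have hrs : star r = r := by simp [hr]
  set χ : ι → ℂ := fun i => P i k / r with hχ
  have hχs : ∀ i, star (χ i) = P k i / r := fun i => by
    simp only [hχ, star_div₀, hrs, hP.isHermitian.apply]
  have hχ1 : ∑ i, star (χ i) * χ i = 1 := by
    have : ∀ i, star (χ i) * χ i = star (P i k) * P i k / P k k := fun i => by
      rw [hχs, hP.isHermitian.apply, ← hrr]; simp only [hχ]; field_simp
    simp_rw [this, ← Finset.sum_div, hnorm]
    exact div_self hk
  set R : Matrix ι ι ℂ := Matrix.of fun i j => χ i * star (χ j) with hR
  have hRR : R * R = R := by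
    ext i j
    simp only [hR, Matrix.mul_apply, Matrix.of_apply]
    have : ∀ x, χ i * star (χ x) * (χ x * star (χ j))
        = (star (χ x) * χ x) * (χ i * star (χ j)) := fun x => by ring
    simp_rw [this, ← Finset.sum_mul, hχ1, one_mul]
  have hRh : Rᴴ = R := by
    ext i j
    simp only [hR, Matrix.conjTranspose_apply, Matrix.of_apply, star_mul', star_star]
    ring
  have hPR : P * R = R := by
    ext i j
    simp only [hR, Matrix.mul_apply, Matrix.of_apply, ← mul_assoc, ← Finset.sum_mul]
    congr 1
    have h := congrFun (congrFun hP.mul_self i) k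
    rw [Matrix.mul_apply] at h
    simp only [hχ, mul_div_assoc', ← Finset.sum_div, h]
  have hRP : R * P = R := by
    have h := congrArg Matrix.conjTranspose hPR
    rwa [Matrix.conjTranspose_mul, hRh, hP.isHermitian.eq] at h
  have hRt : R.trace = 1 := by
    rw [← hχ1]
    simp only [Matrix.trace, Matrix.diag, hR, Matrix.of_apply, mul_comm]
  have hzero : P - R = 0 := by
    rw [← Matrix.trace_conjTranspose_mul_self_eq_zero_iff, Matrix.conjTranspose_sub, hRh,
      hP.isHermitian.eq, Matrix.sub_mul, Matrix.mul_sub, Matrix.mul_sub, hP.mul_self, hPR, hRP,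
      hRR, sub_self, sub_zero, Matrix.trace_sub, hRt, hP.trace_eq_one, sub_self]
  refine ⟨χ, fun i j => ?_, hχ1⟩
  rw [sub_eq_zero.1 hzero]; rfl

theorem norm_apply_le_one (hP : IsPureState P) (i j : ι) : ‖P i j‖ ≤ 1 := by
  obtain ⟨χ, h, h1⟩ := hP.exists_vec
  have hχ : ∀ k, ‖χ k‖ ≤ 1 := fun k => by
    have h2 : ∑ i, ‖χ i‖ ^ 2 = 1 := by
      have : ∀ i, star (χ i) * χ i = ((‖χ i‖ ^ 2 : ℝ) : ℂ) := fun i => by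
        rw [RCLike.star_def, ← Complex.normSq_eq_conj_mul_self, Complex.normSq_eq_norm_sq]
      simp_rw [this] at h1
      exact_mod_cast h1
    have h3 := Finset.single_le_sum (f := fun i => ‖χ i‖ ^ 2) (fun i _ => sq_nonneg _)
      (Finset.mem_univ k)
    rw [h2] at h3
    nlinarith [norm_nonneg (χ k)]
  rw [h, norm_mul, norm_star]
  exact mul_le_one₀ (hχ i) (norm_nonneg _) (hχ j)

theorem trace_mul_re_nonneg (hP : IsPureState P) (hQ : IsPureState Q) :
    0 ≤ (P * Q).trace.re := by
  have h : (P * Q).trace = ((Q * P)ᴴ * (Q * P)).trace := by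
    rw [Matrix.conjTranspose_mul, hP.isHermitian.eq, hQ.isHermitian.eq, Matrix.mul_assoc,
      ← Matrix.mul_assoc Q Q P, hQ.mul_self, Matrix.trace_mul_comm, Matrix.trace_mul_comm P,
      Matrix.mul_assoc, hP.mul_self]
  rw [h]
  exact (Complex.nonneg_iff.1 (Matrix.posSemidef_conjTranspose_mul_self (Q * P)).trace_nonneg).1

theorem trace_sub_sq (hP : IsPureState P) (hQ : IsPureState Q) :
    ((P - Q) * (P - Q)).trace = 2 - 2 * (P * Q).trace := by
  rw [Matrix.sub_mul, Matrix.mul_sub, Matrix.mul_sub, hP.mul_self, hQ.mul_self,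
    Matrix.trace_sub, Matrix.trace_sub, Matrix.trace_sub, Matrix.trace_mul_comm Q P,
    hP.trace_eq_one, hQ.trace_eq_one]
  ring

theorem norm_sub_apply_sq_le (hP : IsPureState P) (hQ : IsPureState Q) (i j : ι) :
    ‖P i j - Q i j‖ ^ 2 ≤ 2 - 2 * (P * Q).trace.re := by
  have h : ((P - Q)ᴴ * (P - Q)).trace.re = 2 - 2 * (P * Q).trace.re := by
    rw [Matrix.conjTranspose_sub, hP.isHermitian.eq, hQ.isHermitian.eq, hP.trace_sub_sq hQ]
    simp
  rw [← h]
  simp only [Matrix.trace, Matrix.diag, Matrix.mul_apply, Matrix.conjTranspose_apply,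
    Complex.re_sum, RCLike.star_def, ← Complex.normSq_eq_conj_mul_self, Complex.ofReal_re,
    Complex.normSq_eq_norm_sq]
  refine le_trans ?_ (Finset.single_le_sum
    (f := fun j => ∑ i, ‖(P - Q) i j‖ ^ 2) (fun _ _ => by positivity) (Finset.mem_univ j))
  exact Finset.single_le_sum (f := fun i => ‖(P - Q) i j‖ ^ 2) (fun _ _ => by positivity)
    (Finset.mem_univ i)

theorem trace_mul_re_le_one (hP : IsPureState P) (hQ : IsPureState Q) :
    (P * Q).trace.re ≤ 1 := by
  obtain ⟨k⟩ : Nonempty ι := by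
    by_contra h
    rw [not_nonempty_iff] at h
    have h1 := hP.trace_eq_one
    simp [Matrix.trace] at h1
  have := (sq_nonneg _).trans (hP.norm_sub_apply_sq_le hQ k k)
  linarith

/-- Conjugation by a unitary matrix preserves pure states. -/
theorem unitary_conj [DecidableEq ι] (hP : IsPureState P) {U : Matrix ι ι ℂ}
    (hU : U ∈ Matrix.unitaryGroup ι ℂ) : IsPureState (U * P * star U) := by
  have hU' : star U * U = 1 := Matrix.mem_unitaryGroup_iff'.1 hU
  refine ⟨Matrix.isHermitian_mul_mul_conjTranspose U hP.isHermitian, ?_, ?_⟩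
  · calc U * P * star U * (U * P * star U) = U * P * (star U * U) * P * star U := by
          simp only [Matrix.mul_assoc]
      _ = U * (P * P) * star U := by rw [hU', Matrix.mul_one, Matrix.mul_assoc U]
      _ = _ := by rw [hP.mul_self]
  · rw [Matrix.trace_mul_comm, ← Matrix.mul_assoc, hU', Matrix.one_mul, hP.trace_eq_one]

end IsPureState

/-- Two unit vectors `ψ`, `φ` with real inner product whose rank-one commutator is diagonal. -/
theorem forall_eq_or_equator_of_offDiag {ι : Type*} [Fintype ι] {ψ φ : ι → ℂ}
    (hφ : ∑ i, star (φ i) * φ i = 1)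
    (hreal : ∑ i, ψ i * star (φ i) = ∑ i, φ i * star (ψ i))
    (hoff : ∀ i j, i ≠ j → ψ i * star (φ j) = φ i * star (ψ j)) :
    (∀ i, ψ i * star (φ i) = φ i * star (ψ i)) ∨
      ∃ k l, k ≠ l ∧ φ k * star (φ k) = 1 / 2 ∧ φ l * star (φ l) = 1 / 2 ∧
        ∀ j, j ≠ k → j ≠ l → φ j = 0 := by
  classical
  refine or_iff_not_imp_left.2 fun h => ?_
  obtain ⟨k, hk⟩ := not_forall.1 h
  obtain ⟨l, hlk, hl⟩ : ∃ l, l ≠ k ∧ ψ l * star (φ l) ≠ φ l * star (ψ l) := by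
    by_contra! h'
    apply hk
    rw [← Finset.add_sum_erase _ _ (Finset.mem_univ k),
      ← Finset.add_sum_erase _ (fun i => φ i * star (ψ i)) (Finset.mem_univ k)] at hreal
    rw [Finset.sum_congr rfl fun i hi => h' i (Finset.ne_of_mem_erase hi)] at hreal
    exact add_right_cancel hreal
  have hkl := hoff k l hlk.symm
  have hlk' := hoff l k hlk
  have hsupp : ∀ j, j ≠ k → j ≠ l → φ j = 0 := fun j hjk hjl => by
    have h1 := hoff j k hjk
    have h2 := hoff j l hjl
    have hdet : star (ψ k) * star (φ l) - star (φ k) * star (ψ l) ≠ 0 := fun h0 => by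
      have hφl : φ l ≠ 0 := fun h => hl (by simp [h])
      apply hk
      have hs : star (φ l) ≠ 0 := by simpa using hφl
      apply mul_right_cancel₀ hs
      linear_combination star (φ k) * hkl - φ k * h0
    apply (mul_eq_zero.1 _).resolve_right hdet
    linear_combination star (φ k) * h2 - star (φ l) * h1
  have htwo : ∀ g : ι → ℂ, (∀ j, j ≠ k → j ≠ l → g j = 0) → ∑ i, g i = g k + g l :=
    fun g hg => Fintype.sum_eq_add k l hlk.symm fun x hx => hg x hx.1 hx.2
  have hsum : φ k * star (φ k) + φ l * star (φ l) = 1 := by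
    rw [htwo _ fun j h1 h2 => by simp [hsupp j h1 h2]] at hφ
    linear_combination hφ
  rw [htwo _ fun j h1 h2 => by simp [hsupp j h1 h2],
    htwo _ fun j h1 h2 => by simp [hsupp j h1 h2]] at hreal
  have heq : φ k * star (φ k) = φ l * star (φ l) := by
    apply mul_left_cancel₀ (sub_ne_zero.2 hk)
    have e1 : ψ k * star (φ k) * (φ l * star (φ l)) = φ k * star (φ k) * (φ l * star (ψ l)) := by
      linear_combination star (φ k) * φ l * hkl
    have e2 : φ k * star (ψ k) * (φ l * star (φ l)) = φ k * star (φ k) * (ψ l * star (φ l)) := by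
      linear_combination (-φ k * star (φ l)) * hlk'
    linear_combination -e1 + e2 + φ k * star (φ k) * hreal
  refine ⟨k, l, hlk.symm, ?_, ?_, hsupp⟩
  · linear_combination hsum / 2 + heq / 2
  · linear_combination hsum / 2 - heq / 2

/-- Two non-orthogonal pure states with diagonal commutator are equal, unless they lie on the
equator of the Bloch sphere of a coordinate plane. -/
theorem IsPureState.eq_or_equator_of_commutator_diag {ι : Type*} [Fintype ι]
    {P Q : Matrix ι ι ℂ} (hP : IsPureState P) (hQ : IsPureState Q)
    (hpos : 0 < (P * Q).trace.re) (hoff : ∀ i j, i ≠ j → (P * Q - Q * P) i j = 0) :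
    P = Q ∨ ∃ k l, k ≠ l ∧ Q k k = 1 / 2 ∧ Q l l = 1 / 2 ∧ ‖Q k l‖ = 1 / 2 ∧
      ∀ i j, ((i ≠ k ∧ i ≠ l) ∨ (j ≠ k ∧ j ≠ l)) → Q i j = 0 := by
  obtain ⟨χ, hχ, hχ1⟩ := hP.exists_vec
  obtain ⟨φ, hφ, hφ1⟩ := hQ.exists_vec
  set s : ℂ := ∑ i, star (χ i) * φ i with hs
  have hss : star s = ∑ i, star (φ i) * χ i := by
    simp only [hs, star_sum, star_mul', star_star]
    exact Finset.sum_congr rfl fun i _ => mul_comm _ _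
  have hPQ : ∀ i j, (P * Q) i j = χ i * s * star (φ j) := fun i j => by
    simp only [Matrix.mul_apply, hχ, hφ, hs, Finset.mul_sum, Finset.sum_mul]
    exact Finset.sum_congr rfl fun i _ => by ring
  have hQP : ∀ i j, (Q * P) i j = φ i * star s * star (χ j) := fun i j => by
    simp only [Matrix.mul_apply, hχ, hφ, hss, Finset.mul_sum, Finset.sum_mul]
    exact Finset.sum_congr rfl fun i _ => by ring
  have htr : (P * Q).trace = s * star s := by
    simp only [Matrix.trace, Matrix.diag, hPQ, hss, Finset.mul_sum]
    exact Finset.sum_congr rfl fun i _ => by ring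
  have hs0 : s * star s ≠ 0 := fun h => by rw [htr, h] at hpos; simp at hpos
  have hPQP : P * Q * P = (s * star s) • P := by
    ext i j
    rw [Matrix.mul_apply]
    simp only [hPQ, hχ, Matrix.smul_apply, smul_eq_mul, hss, Finset.mul_sum, Finset.sum_mul]
    exact Finset.sum_congr rfl fun i _ => by ring
  have hQPQ : Q * P * Q = (s * star s) • Q := by
    ext i j
    rw [Matrix.mul_apply]
    simp only [hQP, hφ, Matrix.smul_apply, smul_eq_mul]
    simp only [hs, Finset.sum_mul]
    exact Finset.sum_congr rfl fun i _ => by ring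
  have key := forall_eq_or_equator_of_offDiag (ψ := fun i => χ i * s) (φ := φ) hφ1 (by
      have e1 : ∑ i, χ i * s * star (φ i) = s * star s := by
        rw [hss, Finset.mul_sum]; exact Finset.sum_congr rfl fun i _ => by ring
      have e2 : ∑ i, φ i * star (χ i * s) = s * star s := by
        simp only [star_mul']
        rw [mul_comm]
        conv_rhs => rw [hs, Finset.mul_sum]
        exact Finset.sum_congr rfl fun i _ => by ring
      rw [e1, e2])
    (fun i j hij => by
      have h := hoff i j hij
      rw [Matrix.sub_apply, hPQ, hQP] at h
      simp only [star_mul']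
      linear_combination h)
  rcases key with h | ⟨k, l, hkl, hk, hl, h0⟩
  · left
    have hcomm : P * Q = Q * P := by
      ext i j
      by_cases hij : i = j
      · subst hij
        rw [hPQ, hQP]
        have := h i
        simp only [star_mul'] at this
        linear_combination this
      · exact sub_eq_zero.1 (hoff i j hij)
    have h1 : (s * star s) • P = (s * star s) • Q := by
      rw [← hPQP, ← hQPQ, Matrix.mul_assoc, ← hcomm, ← Matrix.mul_assoc, hP.mul_self,
        Matrix.mul_assoc, hQ.mul_self]
    exact smul_right_injective _ hs0 h1
  · refine Or.inr ⟨k, l, hkl, (hφ k k).trans hk, (hφ l l).trans hl, ?_, ?_⟩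
    · have hn : ‖φ k * star (φ k)‖ * ‖φ l * star (φ l)‖ = 1 / 4 := by
        rw [hk, hl]; norm_num
      simp only [norm_mul, norm_star] at hn
      rw [hφ, norm_mul, norm_star]
      have : 0 ≤ ‖φ k‖ * ‖φ l‖ := by positivity
      nlinarith
    · rintro i j (⟨h1, h2⟩ | ⟨h1, h2⟩) <;> simp [hφ, h0 _ h1 h2]

/-- Entrywise derivative of a matrix-valued function. -/
def HasMatrixDerivAt {ι : Type*} (X : ℝ → Matrix ι ι ℂ) (X' : Matrix ι ι ℂ) (t : ℝ) : Prop :=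
  ∀ i j, HasDerivAt (fun s => X s i j) (X' i j) t

namespace HasMatrixDerivAt

variable {ι : Type*} {X Y : ℝ → Matrix ι ι ℂ} {X' Y' : Matrix ι ι ℂ} {t : ℝ}

theorem const (C : Matrix ι ι ℂ) : HasMatrixDerivAt (fun _ => C) 0 t :=
  fun _ _ => hasDerivAt_const _ _

theorem sub (hX : HasMatrixDerivAt X X' t) (hY : HasMatrixDerivAt Y Y' t) :
    HasMatrixDerivAt (fun s => X s - Y s) (X' - Y') t :=
  fun i j => (hX i j).sub (hY i j)

theorem const_smul (c : ℂ) (hX : HasMatrixDerivAt X X' t) :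
    HasMatrixDerivAt (fun s => c • X s) (c • X') t :=
  fun i j => (hX i j).const_mul c

theorem conjTranspose (hX : HasMatrixDerivAt X X' t) :
    HasMatrixDerivAt (fun s => (X s)ᴴ) X'ᴴ t :=
  fun i j => (hX j i).star

variable [Fintype ι]

theorem mul (hX : HasMatrixDerivAt X X' t) (hY : HasMatrixDerivAt Y Y' t) :
    HasMatrixDerivAt (fun s => X s * Y s) (X' * Y t + X t * Y') t := fun i j => by
  simp only [Matrix.add_apply, Matrix.mul_apply, ← Finset.sum_add_distrib]
  exact HasDerivAt.fun_sum fun k _ => (hX i k).mul (hY k j)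

theorem trace (hX : HasMatrixDerivAt X X' t) :
    HasDerivAt (fun s => (X s).trace) X'.trace t := by
  simp only [Matrix.trace, Matrix.diag]
  exact HasDerivAt.fun_sum fun k _ => hX k k

theorem re_trace (hX : HasMatrixDerivAt X X' t) :
    HasDerivAt (fun s => (X s).trace.re) X'.trace.re t :=
  Complex.reCLM.hasFDerivAt.comp_hasDerivAt t hX.trace

end HasMatrixDerivAt

section Conservation

variable {ι : Type*} [Fintype ι] {X A : ℝ → Matrix ι ι ℂ}

theorem eq_zero_of_commutator_ode (hA : ∀ t, (A t).IsHermitian)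
    (hX : ∀ t, HasMatrixDerivAt X ((-I) • (A t * X t - X t * A t)) t) (h0 : X 0 = 0) (t : ℝ) :
    X t = 0 := by
  have hd : ∀ t, HasDerivAt (fun s => ((X s)ᴴ * X s).trace) 0 t := fun t => by
    convert ((hX t).conjTranspose.mul (hX t)).trace using 1
    simp only [Matrix.conjTranspose_smul, Matrix.conjTranspose_sub, Matrix.conjTranspose_mul,
      (hA t).eq, star_neg, RCLike.star_def, Complex.conj_I, neg_neg, Matrix.smul_mul,
      Matrix.mul_smul, Matrix.sub_mul, Matrix.mul_sub, Matrix.trace_add, Matrix.trace_smul,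
      Matrix.trace_sub, smul_eq_mul, Matrix.mul_assoc]
    rw [Matrix.trace_mul_comm (A t), Matrix.mul_assoc]
    ring
  have hc := is_const_of_deriv_eq_zero (fun t => (hd t).differentiableAt)
    (fun t => (hd t).deriv) t 0
  simp only [h0, Matrix.mul_zero, Matrix.trace_zero] at hc
  exact Matrix.trace_conjTranspose_mul_self_eq_zero_iff.1 hc

theorem IsPureState.of_commutator_ode (hA : ∀ t, (A t).IsHermitian)
    (hX : ∀ t, HasMatrixDerivAt X ((-I) • (A t * X t - X t * A t)) t) (h0 : IsPureState (X 0))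
    (t : ℝ) : IsPureState (X t) := by
  refine ⟨?_, ?_, ?_⟩
  · have h := eq_zero_of_commutator_ode (X := fun s => (X s)ᴴ - X s) hA (fun t => by
      convert (hX t).conjTranspose.sub (hX t) using 1
      simp only [Matrix.conjTranspose_smul, Matrix.conjTranspose_sub, Matrix.conjTranspose_mul,
        (hA t).eq, star_neg, RCLike.star_def, Complex.conj_I, neg_neg]
      simp only [Matrix.mul_sub, Matrix.sub_mul, smul_sub, neg_smul]
      abel) (sub_eq_zero.2 h0.isHermitian.eq) t
    exact sub_eq_zero.1 h
  · have h := eq_zero_of_commutator_ode (X := fun s => X s * X s - X s) hA (fun t => by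
      convert ((hX t).mul (hX t)).sub (hX t) using 1
      simp only [Matrix.mul_sub, Matrix.sub_mul, smul_sub, neg_smul, Matrix.smul_mul,
        Matrix.mul_smul, Matrix.mul_assoc, Matrix.neg_mul, Matrix.mul_neg]
      abel) (sub_eq_zero.2 h0.mul_self) t
    exact sub_eq_zero.1 h
  · have hd : ∀ t, HasDerivAt (fun s => (X s).trace) 0 t := fun t => by
      convert (hX t).trace using 1
      rw [Matrix.trace_smul, Matrix.trace_sub, Matrix.trace_mul_comm, sub_self, smul_zero]
    rw [is_const_of_deriv_eq_zero (fun t => (hd t).differentiableAt)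
      (fun t => (hd t).deriv) t 0, h0.trace_eq_one]

end Conservation

theorem IsPureState.isClosed_setOf {ι : Type*} [Fintype ι] :
    IsClosed {P : Matrix ι ι ℂ | IsPureState P} := by
  have : {P : Matrix ι ι ℂ | IsPureState P} =
      {P | Pᴴ = P} ∩ {P | P * P = P} ∩ {P | P.trace = 1} := by
    ext P
    exact ⟨fun h => ⟨⟨h.1, h.2⟩, h.3⟩, fun h => ⟨h.1.1, h.1.2, h.2⟩⟩
  rw [this]
  exact ((isClosed_eq (by fun_prop) (by fun_prop)).inter
    (isClosed_eq (by fun_prop) (by fun_prop))).inter (isClosed_eq (by fun_prop) (by fun_prop))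

/-- A matrix-valued function with uniformly bounded entries. -/
def IsEntryBounded {ι : Type*} (X : ℝ → Matrix ι ι ℂ) : Prop :=
  ∃ C, ∀ t i j, ‖X t i j‖ ≤ C

namespace IsEntryBounded

variable {ι : Type*} {X Y : ℝ → Matrix ι ι ℂ}

theorem const [Finite ι] (C : Matrix ι ι ℂ) : IsEntryBounded fun _ => C := by
  obtain ⟨B, hB⟩ := (Set.finite_range fun p : ι × ι => ‖C p.1 p.2‖).bddAbove
  exact ⟨B, fun _ i j => hB ⟨(i, j), rfl⟩⟩

theorem add (hX : IsEntryBounded X) (hY : IsEntryBounded Y) :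
    IsEntryBounded fun t => X t + Y t := by
  obtain ⟨C, hC⟩ := hX
  obtain ⟨D, hD⟩ := hY
  exact ⟨C + D, fun t i j => (norm_add_le _ _).trans (add_le_add (hC t i j) (hD t i j))⟩

theorem smul {c : ℝ → ℂ} {B : ℝ} (hc : ∀ t, ‖c t‖ ≤ B) (hX : IsEntryBounded X) :
    IsEntryBounded fun t => c t • X t := by
  obtain ⟨C, hC⟩ := hX
  refine ⟨B * C, fun t i j => ?_⟩
  change ‖c t * X t i j‖ ≤ B * C
  rw [norm_mul]
  exact mul_le_mul (hc t) (hC t i j) (norm_nonneg _) ((norm_nonneg _).trans (hc t))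

theorem sub (hX : IsEntryBounded X) (hY : IsEntryBounded Y) :
    IsEntryBounded fun t => X t - Y t := by
  obtain ⟨C, hC⟩ := hX
  obtain ⟨D, hD⟩ := hY
  exact ⟨C + D, fun t i j => (norm_sub_le _ _).trans (add_le_add (hC t i j) (hD t i j))⟩

variable [Fintype ι]

theorem mul (hX : IsEntryBounded X) (hY : IsEntryBounded Y) :
    IsEntryBounded fun t => X t * Y t := by
  obtain ⟨C, hC⟩ := hX
  obtain ⟨D, hD⟩ := hY
  refine ⟨∑ _k : ι, C * D, fun t i j => ?_⟩
  change ‖∑ k, X t i k * Y t k j‖ ≤ _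
  refine norm_sum_le_of_le _ fun k _ => ?_
  rw [norm_mul]
  exact mul_le_mul (hC t i k) (hD t k j) (norm_nonneg _) ((norm_nonneg _).trans (hC t i k))

theorem trace (hX : IsEntryBounded X) : ∃ C, ∀ t, ‖(X t).trace‖ ≤ C := by
  obtain ⟨C, hC⟩ := hX
  exact ⟨∑ _k : ι, C, fun t => norm_sum_le_of_le _ fun k _ => hC t k k⟩

end IsEntryBounded

open Filter Topology

/-- Barbalat's lemma: if `v` converges and its derivative is Lipschitz, then the derivative
tends to zero. -/
theorem tendsto_deriv_zero_of_tendsto {v h h' : ℝ → ℝ} {L M : ℝ}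
    (hv : ∀ t, HasDerivAt v (h t) t) (hh : ∀ t, HasDerivAt h (h' t) t) (hM : ∀ t, |h' t| ≤ M)
    (hL : Tendsto v atTop (𝓝 L)) : Tendsto h atTop (𝓝 0) := by
  have hM0 : 0 ≤ M := (abs_nonneg _).trans (hM 0)
  have hlip : ∀ s t, |h t - h s| ≤ M * |t - s| := fun s t => by
    have := convex_univ.norm_image_sub_le_of_norm_hasDerivWithin_le
      (fun x _ => (hh x).hasDerivWithinAt) (fun x _ => hM x) (Set.mem_univ s) (Set.mem_univ t)
    simpa using this
  rw [Metric.tendsto_atTop]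
  intro ε hε
  set δ : ℝ := ε / (2 * (M + 1)) with hδ
  have hδ0 : 0 < δ := by positivity
  have hMδ : M * δ < ε / 2 := by
    have : (M + 1) * δ = ε / 2 := by rw [hδ]; field_simp
    nlinarith
  obtain ⟨T, hT⟩ := Metric.tendsto_atTop.1 hL (ε * δ / 4) (by positivity)
  refine ⟨T, fun t ht => ?_⟩
  obtain ⟨ξ, ⟨h1, h2⟩, hξ⟩ := exists_hasDerivAt_eq_slope v h (show t < t + δ by linarith)
    (fun x _ => (hv x).continuousAt.continuousWithinAt) (fun x _ => hv x)
  have e1 := hT t ht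
  have e2 := hT (t + δ) (by linarith)
  rw [Real.dist_eq, abs_lt] at e1 e2
  have hξ' : h ξ * δ = v (t + δ) - v t := by
    rw [hξ, add_sub_cancel_left, div_mul_cancel₀ _ hδ0.ne']
  have hξ1 : |h ξ| < ε / 2 := by
    rw [abs_lt]
    constructor <;> nlinarith
  have h3 := hlip ξ t
  have h4 : |t - ξ| ≤ δ := by rw [abs_le]; constructor <;> linarith
  have h5 : M * |t - ξ| ≤ M * δ := by gcongr
  rw [Real.dist_eq, sub_zero]
  calc |h t| = |(h t - h ξ) + h ξ| := by ring_nf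
    _ ≤ |h t - h ξ| + |h ξ| := abs_add_le _ _
    _ < ε := by linarith

theorem tendsto_shift_sub_of_deriv_tendsto_zero {E : Type*} [NormedAddCommGroup E]
    [NormedSpace ℝ E] {g g' : ℝ → E} (hg : ∀ t, HasDerivAt g (g' t) t)
    (h0 : Tendsto g' atTop (𝓝 0)) (s : ℝ) :
    Tendsto (fun t => g (t + s) - g t) atTop (𝓝 0) := by
  rw [Metric.tendsto_atTop] at h0 ⊢
  intro ε hε
  obtain ⟨T, hT⟩ := h0 (ε / (|s| + 1)) (by positivity)
  refine ⟨T + |s|, fun t ht => ?_⟩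
  have h1 : t ∈ Set.Ici T := by rw [Set.mem_Ici]; linarith [abs_nonneg s]
  have h2 : t + s ∈ Set.Ici T := by rw [Set.mem_Ici]; linarith [neg_abs_le s]
  have := (convex_Ici T).norm_image_sub_le_of_norm_hasDerivWithin_le
    (fun x _ => (hg x).hasDerivWithinAt)
    (fun x hx => by simpa using (hT x hx).le) h1 h2
  rw [dist_zero_right]
  refine this.trans_lt ?_
  rw [add_sub_cancel_left, Real.norm_eq_abs, div_mul_eq_mul_div, div_lt_iff₀ (by positivity)]
  nlinarith [abs_nonneg s]

theorem hasDerivAt_exp_mul_I (x t : ℝ) :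
    HasDerivAt (fun s : ℝ => exp ((x * s : ℝ) * I)) (exp ((x * t : ℝ) * I) * (x * I)) t := by
  have h1 : HasDerivAt (fun s : ℝ => ((x * s : ℝ) : ℂ) * I) (x * I) t := by
    have := (((hasDerivAt_id t).const_mul x).ofReal_comp).mul_const I
    simpa using this
  exact h1.cexp

theorem eq_zero_of_sum_exp_eq_zero {J : Type*} [Fintype J] {ω : J → ℝ}
    (hω : Function.Injective ω) {d : J → ℂ}
    (h : ∀ s : ℝ, ∑ j, d j * exp ((ω j * s : ℝ) * I) = 0) (j : J) : d j = 0 := by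
  let e : J → (Multiplicative ℝ →* ℂ) := fun j =>
    { toFun := fun s => exp ((ω j * s.toAdd : ℝ) * I)
      map_one' := by simp
      map_mul' := fun x y => by
        rw [← Complex.exp_add, toAdd_mul]; push_cast; ring_nf }
  have he : Function.Injective e := fun i j hij => by
    apply hω
    have hfun : (fun s : ℝ => exp ((ω i * s : ℝ) * I)) = fun s : ℝ => exp ((ω j * s : ℝ) * I) := by
      funext s
      exact DFunLike.congr_fun hij (Multiplicative.ofAdd s)
    have h1 := (hasDerivAt_exp_mul_I (ω i) 0).unique (hfun ▸ hasDerivAt_exp_mul_I (ω j) 0)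
    simpa using h1
  have hli := (linearIndependent_monoidHom (Multiplicative ℝ) ℂ).comp e he
  refine Fintype.linearIndependent_iff.1 hli d ?_ j
  funext s
  simpa [e, Finset.sum_apply] using h s.toAdd

/-- Conjugation of `X` by `exp (i t diag a)`, the passage to the interaction picture. -/
noncomputable def interactionPicture {ι : Type*} (a : ι → ℝ) (t : ℝ) (X : Matrix ι ι ℂ) :
    Matrix ι ι ℂ :=
  Matrix.of fun i j => exp (((a i - a j) * t : ℝ) * I) * X i j

namespace interactionPicture

variable {ι : Type*} (a : ι → ℝ) (s t : ℝ) (X Y : Matrix ι ι ℂ)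

theorem apply (i j : ι) :
    interactionPicture a t X i j = exp (((a i - a j) * t : ℝ) * I) * X i j := rfl

theorem norm_apply (i j : ι) : ‖interactionPicture a t X i j‖ = ‖X i j‖ := by
  rw [apply, norm_mul, Complex.norm_exp_ofReal_mul_I, one_mul]

theorem zero_time : interactionPicture a 0 X = X := by
  ext i j; simp [apply]

theorem add_time :
    interactionPicture a (t + s) X = interactionPicture a s (interactionPicture a t X) := by
  ext i j
  simp only [apply, ← mul_assoc, ← Complex.exp_add]
  congr 2
  push_cast; ring

theorem sub : interactionPicture a t (X - Y) =
    interactionPicture a t X - interactionPicture a t Y := by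
  ext i j; simp only [apply, Matrix.sub_apply]; ring

theorem smul (c : ℂ) : interactionPicture a t (c • X) = c • interactionPicture a t X := by
  ext i j; simp only [apply, Matrix.smul_apply, smul_eq_mul]; ring

theorem mul [Fintype ι] : interactionPicture a t (X * Y) =
    interactionPicture a t X * interactionPicture a t Y := by
  ext i j
  simp only [apply, Matrix.mul_apply, Finset.mul_sum]
  refine Finset.sum_congr rfl fun k _ => ?_
  have : exp (((a i - a j) * t : ℝ) * I) =
      exp (((a i - a k) * t : ℝ) * I) * exp (((a k - a j) * t : ℝ) * I) := by
    rw [← Complex.exp_add]; congr 1; push_cast; ring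
  rw [this]; ring

theorem trace [Fintype ι] : (interactionPicture a t X).trace = X.trace := by
  simp [Matrix.trace, apply]

theorem isHermitian {X : Matrix ι ι ℂ} (hX : X.IsHermitian) :
    (interactionPicture a t X).IsHermitian := by
  ext i j
  rw [Matrix.conjTranspose_apply, apply, apply, star_mul', hX.apply, RCLike.star_def,
    ← Complex.exp_conj, map_mul, Complex.conj_ofReal, Complex.conj_I]
  congr 2
  push_cast; ring

theorem hasMatrixDerivAt : HasMatrixDerivAt (fun s => interactionPicture a s X)
    (interactionPicture a t (Matrix.of fun i j => ((a i - a j : ℝ) * I) * X i j)) t := by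
  intro i j
  simp only [apply, Matrix.of_apply, ← mul_assoc]
  have := (hasDerivAt_exp_mul_I (a i - a j) t).mul_const (X i j)
  simpa only [← mul_assoc] using this

theorem isEntryBounded [Finite ι] : IsEntryBounded fun t => interactionPicture a t X := by
  obtain ⟨C, hC⟩ := IsEntryBounded.const X
  exact ⟨C, fun t i j => (norm_apply a t X i j).trans_le (hC t i j)⟩

theorem continuous : Continuous (interactionPicture a t) := by
  refine continuous_matrix fun i j => ?_
  simp only [apply]
  fun_prop

/-- Distinct Bohr frequencies separate the matrix entries. -/
theorem apply_eq_zero_of_trace_mul_eq_zero [Fintype ι] {a : ι → ℝ}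
    (hreg : ∀ k l p q : ι, k ≠ l → p ≠ q → a l - a k = a q - a p → k = p ∧ l = q)
    {H C : Matrix ι ι ℂ} (hdiag : ∀ k, H k k = 0) (hconn : ∀ k l, k ≠ l → H k l ≠ 0)
    (h : ∀ s, (interactionPicture a s H * C).trace = 0) (i j : ι) (hij : i ≠ j) : C i j = 0 := by
  classical
  have hinj : Function.Injective
      (fun p : {p : ι × ι // p.1 ≠ p.2} => a p.1.1 - a p.1.2) := by
    rintro ⟨⟨k, l⟩, hkl⟩ ⟨⟨p, q⟩, hpq⟩ h
    have := hreg l k q p (Ne.symm hkl) (Ne.symm hpq) h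
    simp [this.1, this.2]
  have key := eq_zero_of_sum_exp_eq_zero hinj
    (d := fun p => H p.1.1 p.1.2 * C p.1.2 p.1.1) (fun s => by
      rw [← h s]
      simp only [Matrix.trace, Matrix.diag, Matrix.mul_apply, apply]
      rw [← Fintype.sum_prod_type'
        (f := fun k l => exp (((a k - a l) * s : ℝ) * I) * H k l * C l k)]
      rw [← Finset.sum_filter_of_ne (p := fun x : ι × ι => x.1 ≠ x.2)
        (fun x _ hx heq => hx (by rw [heq, hdiag]; simp)),
        Finset.sum_subtype (p := fun x : ι × ι => x.1 ≠ x.2) _ (by simp)]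
      exact Finset.sum_congr rfl fun x _ => by ring) ⟨(j, i), hij.symm⟩
  exact (mul_eq_zero.1 key).resolve_left (hconn j i hij.symm)

end interactionPicture

theorem smul_commutator {ι : Type*} [Fintype ι] (c : ℂ) (K P : Matrix ι ι ℂ) :
    (c • K) * P - P * (c • K) = c • (K * P - P * K) := by
  rw [Matrix.smul_mul, Matrix.mul_smul, smul_sub]

theorem trace_commutator_im_eq_zero {ι : Type*} [Fintype ι] {K P Q : Matrix ι ι ℂ}
    (hK : K.IsHermitian) (hP : P.IsHermitian) (hQ : Q.IsHermitian) :
    (((-I) • (K * P - P * K)) * Q).trace.im = 0 := by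
  rw [← Complex.conj_eq_iff_im, ← RCLike.star_def, ← Matrix.trace_conjTranspose]
  simp only [Matrix.conjTranspose_mul, Matrix.conjTranspose_smul, Matrix.conjTranspose_sub,
    hK.eq, hP.eq, hQ.eq, star_neg, RCLike.star_def, Complex.conj_I, neg_neg]
  rw [Matrix.trace_mul_comm, Matrix.smul_mul, Matrix.smul_mul, Matrix.trace_smul,
    Matrix.trace_smul, ← neg_sub, Matrix.neg_mul, Matrix.trace_neg]
  simp

theorem trace_commutator_mul {ι : Type*} [Fintype ι] (K P Q : Matrix ι ι ℂ) :
    (((-I) • (K * P - P * K)) * Q).trace = (-I) * (K * (P * Q - Q * P)).trace := by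
  rw [Matrix.smul_mul, Matrix.trace_smul, smul_eq_mul, Matrix.sub_mul, Matrix.mul_sub,
    Matrix.trace_sub, Matrix.trace_sub, Matrix.mul_assoc, Matrix.mul_assoc,
    Matrix.trace_mul_comm P, Matrix.mul_assoc]

theorem continuous_trace_commutator {ι : Type*} [Fintype ι] (Q : Matrix ι ι ℂ) :
    Continuous fun Y : Matrix ι ι ℂ × Matrix ι ι ℂ =>
      (((-I) • (Y.1 * Y.2 - Y.2 * Y.1)) * Q).trace.re := by
  fun_prop

section LaSalle

variable {ι : Type*} [Fintype ι] {a : ι → ℝ} {H Q : Matrix ι ι ℂ} {P : ℝ → Matrix ι ι ℂ} {c : ℝ}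
  {f : ℝ → ℝ}

theorem hasDerivAt_overlap (hc : 0 < c)
    (hf : ∀ t, f t = c * (((-I) • (interactionPicture a t H * P t -
      P t * interactionPicture a t H)) * Q).trace.re)
    (hP : ∀ t, HasMatrixDerivAt P ((-I) • (((f t : ℂ) • interactionPicture a t H) * P t -
      P t * ((f t : ℂ) • interactionPicture a t H))) t) (t : ℝ) :
    HasDerivAt (fun t => (P t * Q).trace.re) (f t ^ 2 / c) t := by
  have h := ((hP t).mul (HasMatrixDerivAt.const Q)).re_trace
  convert h using 1
  have hre := hf t
  have hsmul : ((-I) • (((f t : ℂ) • interactionPicture a t H) * P t -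
      P t * ((f t : ℂ) • interactionPicture a t H)) * Q + P t * 0).trace =
      (f t : ℂ) * (((-I) • (interactionPicture a t H * P t -
        P t * interactionPicture a t H)) * Q).trace := by
    rw [Matrix.mul_zero, add_zero, smul_commutator, smul_comm,
      Matrix.smul_mul, Matrix.trace_smul, smul_eq_mul]
  rw [hsmul, Complex.re_ofReal_mul, div_eq_iff hc.ne', hre]
  ring

theorem tendsto_control_zero (hc : 0 < c) (hpure : ∀ t, IsPureState (P t))
    (hf : ∀ t, f t = c * (((-I) • (interactionPicture a t H * P t -
      P t * interactionPicture a t H)) * Q).trace.re)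
    (hP : ∀ t, HasMatrixDerivAt P ((-I) • (((f t : ℂ) • interactionPicture a t H) * P t -
      P t * ((f t : ℂ) • interactionPicture a t H))) t) {L : ℝ}
    (hL : Tendsto (fun t => (P t * Q).trace.re) atTop (𝓝 L)) :
    Tendsto f atTop (𝓝 0) := by
  have hbP : IsEntryBounded P := ⟨1, fun t i j => (hpure t).norm_apply_le_one i j⟩
  have hbK := interactionPicture.isEntryBounded a H
  have hbQ := IsEntryBounded.const Q
  have hI : ∀ _ : ℝ, ‖-I‖ ≤ 1 := fun _ => by simp
  obtain ⟨B, hB⟩ := (((hbK.mul hbP).sub (hbP.mul hbK)).smul hI |>.mul hbQ).trace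
  have hfB : ∀ t, |f t| ≤ c * B := fun t => by
    rw [hf t, abs_mul, abs_of_pos hc]
    gcongr
    exact (Complex.abs_re_le_norm _).trans (hB t)
  have hbP' := ((((hbK.smul (c := fun t => (f t : ℂ)) (B := c * B)
    fun t => by rw [Complex.norm_real]; exact hfB t)).mul hbP).sub
    (hbP.mul (hbK.smul (c := fun t => (f t : ℂ)) (B := c * B)
      fun t => by rw [Complex.norm_real]; exact hfB t))).smul hI
  have hbK' := interactionPicture.isEntryBounded a
    (Matrix.of fun i j => ((a i - a j : ℝ) * I) * H i j)
  have hK' := fun t => interactionPicture.hasMatrixDerivAt a t H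
  obtain ⟨B', hB'⟩ := ((((((hbK'.mul hbP).add (hbK.mul hbP')).sub
    ((hbP'.mul hbK).add (hbP.mul hbK'))).smul hI).mul hbQ).add
    ((((hbK.mul hbP).sub (hbP.mul hbK)).smul hI).mul (IsEntryBounded.const 0))).trace
  have hdf := fun t => ((((hK' t).mul (hP t)).sub ((hP t).mul (hK' t))).const_smul (-I) |>.mul
    (HasMatrixDerivAt.const Q)).re_trace.const_mul c
  have hdf' : ∀ t, ∃ d, |d| ≤ c * B' ∧ HasDerivAt f d t := fun t => by
    refine ⟨_, ?_, (hdf t).congr_of_eventuallyEq (Eventually.of_forall hf)⟩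
    rw [abs_mul, abs_of_pos hc]
    gcongr
    exact (Complex.abs_re_le_norm _).trans (hB' t)
  choose f' hf'B hf' using hdf'
  have hsq := tendsto_deriv_zero_of_tendsto (M := 2 * (c * B) * (c * B') / c)
    (hasDerivAt_overlap hc hf hP)
    (fun t => ((hf' t).pow 2).div_const c) (fun t => by
      rw [abs_div, abs_of_pos hc]
      gcongr
      rw [abs_mul, abs_mul]
      have h0 := (abs_nonneg _).trans (hfB t)
      gcongr
      · simp
      · simpa using hfB t
      · exact hf'B t) hL
  have hsq' : Tendsto (fun t => f t ^ 2) atTop (𝓝 0) := by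
    have := hsq.mul_const c
    simpa [div_mul_cancel₀ _ hc.ne'] using this
  have habs : Tendsto (fun t => |f t|) atTop (𝓝 0) := by
    have := hsq'.sqrt
    simpa [Real.sqrt_sq_eq_abs] using this
  exact (tendsto_zero_iff_abs_tendsto_zero f).2 habs

/-- Convergence in the interaction picture: the overlap with the target tends to one. -/
theorem tendsto_overlap_one
    (hreg : ∀ k l p q : ι, k ≠ l → p ≠ q → a l - a k = a q - a p → k = p ∧ l = q)
    (hH : H.IsHermitian) (hdiag : ∀ k, H k k = 0) (hconn : ∀ k l, k ≠ l → H k l ≠ 0)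
    (hc : 0 < c) (hP0 : IsPureState (P 0)) (hQ : IsPureState Q)
    (hf : ∀ t, f t = c * (((-I) • (interactionPicture a t H * P t -
      P t * interactionPicture a t H)) * Q).trace.re)
    (hP : ∀ t, HasMatrixDerivAt P ((-I) • (((f t : ℂ) • interactionPicture a t H) * P t -
      P t * ((f t : ℂ) • interactionPicture a t H))) t)
    (hpos : 0 < (P 0 * Q).trace.re)
    (hexc : ¬ ∃ k l, k ≠ l ∧ Q k k = 1 / 2 ∧ Q l l = 1 / 2 ∧ ‖Q k l‖ = 1 / 2 ∧
      ∀ i j, ((i ≠ k ∧ i ≠ l) ∨ (j ≠ k ∧ j ≠ l)) → Q i j = 0) :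
    (∀ t, IsPureState (P t)) ∧ Tendsto (fun t => (P t * Q).trace.re) atTop (𝓝 1) := by
  have hpure : ∀ t, IsPureState (P t) := IsPureState.of_commutator_ode (fun t => by
    have := interactionPicture.isHermitian a t hH
    rw [Matrix.IsHermitian, Matrix.conjTranspose_smul, this.eq]
    simp) hP hP0
  refine ⟨hpure, ?_⟩
  have hv := hasDerivAt_overlap hc hf hP
  have hmono : Monotone fun t => (P t * Q).trace.re :=
    monotone_of_deriv_nonneg (fun t => (hv t).differentiableAt)
      fun t => by rw [(hv t).deriv]; positivity
  have hL := tendsto_atTop_ciSup hmono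
    ⟨1, by rintro _ ⟨t, rfl⟩; exact (hpure t).trace_mul_re_le_one hQ⟩
  set L := ⨆ t, (P t * Q).trace.re
  have hL0 : 0 < L := hpos.trans_le (hmono.ge_of_tendsto hL 0)
  have hf0 := tendsto_control_zero hc hpure hf hP hL
  have hshift : ∀ s, Tendsto (fun t => P (t + s) - P t) atTop (𝓝 0) := fun s => by
    have hbP : IsEntryBounded P := ⟨1, fun t i j => (hpure t).norm_apply_le_one i j⟩
    have hbK := interactionPicture.isEntryBounded a H
    obtain ⟨B, hB⟩ := ((hbK.mul hbP).sub (hbP.mul hbK)).smul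
      (c := fun _ => -I) (B := 1) (fun _ => by simp)
    refine tendsto_pi_nhds.2 fun i => tendsto_pi_nhds.2 fun j => ?_
    refine tendsto_shift_sub_of_deriv_tendsto_zero (fun t => hP t i j) ?_ s
    refine squeeze_zero_norm (a := fun t => |f t| * B) (fun t => ?_) (by
      simpa using hf0.abs.mul_const B)
    rw [smul_commutator, smul_comm, Matrix.smul_apply, norm_smul,
      Complex.norm_real, Real.norm_eq_abs]
    exact mul_le_mul_of_nonneg_left (hB t i j) (abs_nonneg _)
  obtain ⟨⟨M, K⟩, -, φ, hφ, hlim⟩ := ((isCompact_univ_pi fun _ : ι => isCompact_univ_pi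
      fun _ : ι => isCompact_closedBall (0 : ℂ) 1).prod (isCompact_univ_pi fun i : ι =>
        isCompact_univ_pi fun j : ι => isCompact_closedBall (0 : ℂ) ‖H i j‖)).tendsto_subseq
    (x := fun m : ℕ => ((P m, interactionPicture a m H) : (ι → ι → ℂ) × (ι → ι → ℂ)))
    (fun m => ⟨fun i _ j _ => by simpa using (hpure m).norm_apply_le_one i j,
      fun i _ j _ => by simpa using (interactionPicture.norm_apply a m H i j).le⟩)
  have hφt : Tendsto (fun m => ((φ m : ℕ) : ℝ)) atTop atTop :=
    tendsto_natCast_atTop_atTop.comp hφ.tendsto_atTop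
  have hM : Tendsto (fun m => P (φ m)) atTop (𝓝 (M : Matrix ι ι ℂ)) :=
    (continuous_fst.tendsto _).comp hlim
  have hK : Tendsto (fun m => interactionPicture a (φ m) H) atTop (𝓝 (K : Matrix ι ι ℂ)) :=
    (continuous_snd.tendsto _).comp hlim
  change Matrix ι ι ℂ at M K
  have hMpure : IsPureState M :=
    IsPureState.isClosed_setOf.mem_of_tendsto hM (Eventually.of_forall fun m => hpure _)
  have hKn : ∀ i j, ‖K i j‖ = ‖H i j‖ := fun i j => by
    have h1 := ((tendsto_pi_nhds.1 (tendsto_pi_nhds.1 hK i) j)).norm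
    exact tendsto_nhds_unique h1 (by
      simp only [interactionPicture.norm_apply]; exact tendsto_const_nhds)
  have hKh : K.IsHermitian := (isClosed_eq (f := fun X : Matrix ι ι ℂ => Xᴴ) (g := id)
    (by fun_prop) continuous_id).mem_of_tendsto hK
    (Eventually.of_forall fun m => interactionPicture.isHermitian a _ hH)
  have hover : ∀ X : Matrix ι ι ℂ, Tendsto (fun m => (P (φ m) * X).trace.re) atTop
      (𝓝 (M * X).trace.re) := fun X =>
    ((by fun_prop : Continuous fun Y : Matrix ι ι ℂ => (Y * X).trace.re).tendsto M).comp hM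
  have hML : (M * Q).trace.re = L := tendsto_nhds_unique (hover Q) (hL.comp hφt)
  have htrace : ∀ s, (interactionPicture a s K * (M * Q - Q * M)).trace = 0 := fun s => by
    have hM' : Tendsto (fun m => P (φ m + s)) atTop (𝓝 M) := by
      have := ((hshift s).comp hφt).add hM
      simpa using this
    have hK' : Tendsto (fun m => interactionPicture a (φ m + s) H) atTop
        (𝓝 (interactionPicture a s K)) := by
      simp only [interactionPicture.add_time]
      exact ((interactionPicture.continuous a s).tendsto K).comp hK
    have h1 : Tendsto (fun m => f (φ m + s)) atTop (𝓝 (c * (((-I) •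
        (interactionPicture a s K * M - M * interactionPicture a s K)) * Q).trace.re)) := by
      simp only [hf]
      exact (((continuous_trace_commutator Q).tendsto (interactionPicture a s K, M)).comp
        (hK'.prodMk_nhds hM')).const_mul c
    have h2 := tendsto_nhds_unique h1
      (hf0.comp (tendsto_atTop_add_const_right _ s hφt))
    have h3 := (mul_eq_zero.1 h2).resolve_left hc.ne'
    have h4 := trace_commutator_im_eq_zero (interactionPicture.isHermitian a s hKh)
      hMpure.isHermitian hQ.isHermitian
    have h5 := Complex.ext (w := 0) h3 h4
    rw [trace_commutator_mul] at h5
    simpa using h5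
  have hoff := interactionPicture.apply_eq_zero_of_trace_mul_eq_zero hreg
    (fun k => norm_eq_zero.1 (by rw [hKn, hdiag, norm_zero]))
    (fun k l hkl => norm_ne_zero_iff.1 (by rw [hKn]; exact norm_ne_zero_iff.2 (hconn k l hkl)))
    htrace
  have hMQ : M = Q := (hMpure.eq_or_equator_of_commutator_diag hQ (hML ▸ hL0) hoff).resolve_right
    hexc
  have hL1 : L = 1 := by
    rw [← hML, hMQ, hQ.mul_self, hQ.trace_eq_one, Complex.one_re]
  exact hL1 ▸ hL

end LaSalle

/-- Passing to the interaction picture removes the drift Hamiltonian `diag a`. -/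
theorem HasMatrixDerivAt.interactionPicture {ι : Type*} [Fintype ι] [DecidableEq ι] {a : ι → ℝ}
    {X : ℝ → Matrix ι ι ℂ} {A : Matrix ι ι ℂ} {t : ℝ}
    (hX : HasMatrixDerivAt X ((-I) • ((Matrix.diagonal (fun k => (a k : ℂ)) + A) * X t -
      X t * (Matrix.diagonal (fun k => (a k : ℂ)) + A))) t) :
    HasMatrixDerivAt (fun s => _root_.interactionPicture a s (X s))
      (_root_.interactionPicture a t ((-I) • (A * X t - X t * A))) t := by
  intro i j
  refine ((hasDerivAt_exp_mul_I (a i - a j) t).fun_mul (hX i j)).congr_deriv ?_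
  simp only [interactionPicture.apply, Matrix.add_mul, Matrix.mul_add, Matrix.smul_apply,
    Matrix.sub_apply, Matrix.add_apply, Matrix.diagonal_mul, Matrix.mul_diagonal, smul_eq_mul]
  push_cast
  ring

section Normalization

variable {ι : Type*} [DecidableEq ι]

/-- The affine map sending a pseudo-pure state with eigenvalues `w`, `u` to a pure state. -/
noncomputable def purePart (w u : ℝ) (X : Matrix ι ι ℂ) : Matrix ι ι ℂ :=
  ((w - u : ℝ) : ℂ)⁻¹ • (X - (u : ℂ) • 1)

variable {w u : ℝ}

theorem eq_smul_purePart_add (hwu : w ≠ u) (X : Matrix ι ι ℂ) :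
    X = ((w - u : ℝ) : ℂ) • purePart w u X + (u : ℂ) • 1 := by
  have : ((w - u : ℝ) : ℂ) ≠ 0 := by exact_mod_cast sub_ne_zero.2 hwu
  rw [purePart, smul_inv_smul₀ this, sub_add_cancel]

theorem sub_eq_smul_purePart_sub (hwu : w ≠ u) (X Y : Matrix ι ι ℂ) :
    X - Y = ((w - u : ℝ) : ℂ) • (purePart w u X - purePart w u Y) := by
  conv_lhs => rw [eq_smul_purePart_add hwu X, eq_smul_purePart_add hwu Y]
  rw [smul_sub]; abel

theorem purePart_unitary_conj [Fintype ι] {U : Matrix ι ι ℂ} (hU : U ∈ Matrix.unitaryGroup ι ℂ)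
    (X : Matrix ι ι ℂ) : purePart w u (U * X * star U) = U * purePart w u X * star U := by
  have h : U * star U = 1 := Matrix.mem_unitaryGroup_iff.1 hU
  simp only [purePart, Matrix.mul_smul, Matrix.smul_mul, Matrix.mul_sub, Matrix.sub_mul,
    Matrix.mul_one, h]

theorem isPureState_purePart_diagonal {n : ℕ} (hn : 0 < n) (hwu : w ≠ u) :
    IsPureState (purePart w u
      (Matrix.diagonal fun k : Fin n => if k.val = 0 then (w : ℂ) else (u : ℂ))) := by
  have hd : ((w - u : ℝ) : ℂ) ≠ 0 := by exact_mod_cast sub_ne_zero.2 hwu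
  have h : purePart w u (Matrix.diagonal fun k : Fin n => if k.val = 0 then (w : ℂ) else (u : ℂ))
      = Matrix.diagonal fun k : Fin n => if k = ⟨0, hn⟩ then 1 else 0 := by
    ext i j
    by_cases hij : i = j
    · subst hij
      by_cases hi : i.val = 0
      · have : i = ⟨0, hn⟩ := Fin.ext hi
        simp only [purePart, Matrix.smul_apply, Matrix.sub_apply, Matrix.diagonal_apply_eq,
          if_true, Matrix.one_apply_eq, smul_eq_mul, mul_one, this]
        rw [← Complex.ofReal_sub, inv_mul_cancel₀ hd]
      · have : i ≠ ⟨0, hn⟩ := fun h => hi (by rw [h])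
        simp [purePart, hi, this]
    · simp [purePart, hij]
  rw [h]
  refine ⟨?_, ?_, by simp [Matrix.trace]⟩
  · rw [Matrix.IsHermitian, Matrix.diagonal_conjTranspose]
    congr 1; funext k; simp only [Pi.star_apply]; split_ifs <;> simp
  · rw [Matrix.diagonal_mul_diagonal]
    congr 1; funext k; split_ifs <;> simp

theorem half_trace_sub_sq [Fintype ι] (hwu : w ≠ u) {X Y : Matrix ι ι ℂ}
    (hX : IsPureState (purePart w u X)) (hY : IsPureState (purePart w u Y)) :
    (1 / 2 : ℝ) * ((X - Y) ^ 2).trace.re =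
      (w - u) ^ 2 * (1 - (purePart w u X * purePart w u Y).trace.re) := by
  rw [sub_eq_smul_purePart_sub hwu X Y, smul_pow, pow_two (_ - _), Matrix.trace_smul,
    hX.trace_sub_sq hY, smul_eq_mul, ← Complex.ofReal_pow, Complex.re_ofReal_mul]
  simp
  ring

theorem trace_commutator_purePart [Fintype ι] (hwu : w ≠ u) (K X Y : Matrix ι ι ℂ) :
    (((-I) • (K * X - X * K)) * Y).trace = ((w - u : ℝ) : ℂ) ^ 2 *
      (((-I) • (K * purePart w u X - purePart w u X * K)) * purePart w u Y).trace := by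
  rw [trace_commutator_mul, trace_commutator_mul]
  conv_lhs => rw [eq_smul_purePart_add hwu X, eq_smul_purePart_add hwu Y]
  have : ∀ (d u : ℂ) (x y : Matrix ι ι ℂ), (d • x + u • 1) * (d • y + u • 1) -
      (d • y + u • 1) * (d • x + u • 1) = d ^ 2 • (x * y - y * x) := fun d u x y => by
    simp only [Matrix.add_mul, Matrix.mul_add, Matrix.smul_mul, Matrix.mul_smul, Matrix.mul_one,
      Matrix.one_mul, smul_sub, pow_two, mul_smul, smul_add, smul_comm d u]
    abel
  rw [this, Matrix.mul_smul, Matrix.trace_smul, smul_eq_mul]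
  ring

theorem commutator_purePart [Fintype ι] (K X : Matrix ι ι ℂ) :
    K * purePart w u X - purePart w u X * K = ((w - u : ℝ) : ℂ)⁻¹ • (K * X - X * K) := by
  simp only [purePart, Matrix.mul_smul, Matrix.smul_mul, Matrix.mul_sub, Matrix.sub_mul,
    Matrix.mul_one, Matrix.one_mul, smul_sub]
  abel

/-- A target whose pure part is equatorial in a coordinate plane has the exceptional form. -/
theorem exceptional_form_of_equator {ι : Type*} [LinearOrder ι] (hwu : w ≠ u)
    {X : Matrix ι ι ℂ} (hX : X.IsHermitian)
    (h : ∃ k l, k ≠ l ∧ purePart w u X k k = 1 / 2 ∧ purePart w u X l l = 1 / 2 ∧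
      ‖purePart w u X k l‖ = 1 / 2 ∧
      ∀ i j, ((i ≠ k ∧ i ≠ l) ∨ (j ≠ k ∧ j ≠ l)) → purePart w u X i j = 0) :
    ∃ (k l : ι) (α : ℝ), k < l ∧
      X = Matrix.of fun i j =>
        if i = k ∧ j = k then (((w + u) / 2 : ℝ) : ℂ)
        else if i = l ∧ j = l then (((w + u) / 2 : ℝ) : ℂ)
        else if i = k ∧ j = l then (((w - u) / 2 : ℝ) : ℂ) * Complex.exp (Complex.I * α)
        else if i = l ∧ j = k then (((w - u) / 2 : ℝ) : ℂ) * Complex.exp (-(Complex.I * α))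
        else if i = j then (u : ℂ) else 0 := by
  have hQ : ∀ i j, purePart w u X j i = star (purePart w u X i j) := fun i j => by
    have h1 : (1 : Matrix ι ι ℂ) j i = star ((1 : Matrix ι ι ℂ) i j) := by
      rw [← Matrix.conjTranspose_apply, Matrix.conjTranspose_one]
    simp only [purePart, Matrix.smul_apply, Matrix.sub_apply, smul_eq_mul, star_mul', star_sub,
      hX.apply, h1]
    simp
  obtain ⟨k, l, hlt, hk, hl, hkl, h0⟩ : ∃ k l, k < l ∧ purePart w u X k k = 1 / 2 ∧
      purePart w u X l l = 1 / 2 ∧ ‖purePart w u X k l‖ = 1 / 2 ∧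
      ∀ i j, ((i ≠ k ∧ i ≠ l) ∨ (j ≠ k ∧ j ≠ l)) → purePart w u X i j = 0 := by
    obtain ⟨k, l, hne, hk, hl, hkl, h0⟩ := h
    rcases lt_or_gt_of_ne hne with hlt | hlt
    · exact ⟨k, l, hlt, hk, hl, hkl, h0⟩
    · exact ⟨l, k, hlt, hl, hk, by rw [hQ k l, norm_star, hkl],
        fun i j hij => h0 i j (hij.imp And.symm And.symm)⟩
  have hphase : purePart w u X k l = 1 / 2 * exp (I * (arg (purePart w u X k l) : ℝ)) := by
    conv_lhs => rw [← Complex.norm_mul_exp_arg_mul_I (purePart w u X k l), hkl]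
    rw [mul_comm I]; norm_num
  set α := arg (purePart w u X k l)
  have hphase' : purePart w u X l k = 1 / 2 * exp (-(I * α)) := by
    rw [hQ k l, hphase, star_mul', RCLike.star_def, ← Complex.exp_conj, map_mul,
      Complex.conj_I, Complex.conj_ofReal]
    simp [Complex.conj_ofNat]
  refine ⟨k, l, α, hlt, ?_⟩
  ext i j
  conv_lhs => rw [eq_smul_purePart_add hwu X]
  simp only [Matrix.add_apply, Matrix.smul_apply, smul_eq_mul, Matrix.of_apply]
  split_ifs with h1 h2 h3 h4 h5
  · rw [h1.1, h1.2, hk, Matrix.one_apply_eq]; push_cast; ring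
  · rw [h2.1, h2.2, hl, Matrix.one_apply_eq]; push_cast; ring
  · rw [h3.1, h3.2, hphase, Matrix.one_apply_ne hlt.ne]; push_cast; ring
  · rw [h4.1, h4.2, hphase', Matrix.one_apply_ne hlt.ne']; push_cast; ring
  · subst h5
    rw [h0 i i (Or.inl ⟨fun h => h1 ⟨h, h⟩, fun h => h2 ⟨h, h⟩⟩), Matrix.one_apply_eq]; ring
  · rw [h0 i j (by
      by_contra! hcon
      by_cases hik : i = k <;> by_cases hjk : j = k
      · exact h1 ⟨hik, hjk⟩
      · exact h3 ⟨hik, hcon.2 hjk⟩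
      · exact h4 ⟨hcon.1 hik, hjk⟩
      · exact h2 ⟨hcon.1 hik, hcon.2 hjk⟩), Matrix.one_apply_ne h5]
    ring

end Normalization

/-- (Theorem on pseudo-pure target states for ideal systems.)
For `n ≥ 3`, `H₀` strongly regular real diagonal, `H₁` fully connected Hermitian
with zero diagonal, and a pseudo-pure target `ρ_d(0)` (eigenvalues `w` with
multiplicity 1 and `u` with multiplicity `n-1`, `w ≠ u`) which is not of the
exceptional 2×2-block form, every solution of the Lyapunov-controlled system
starting unitarily equivalent to `ρ_d(0)` with `V(0) < V_max` satisfies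
`ρ(t) - ρ_d(t) → 0` as `t → +∞`. -/
theorem stmt16 {n : ℕ} (hn : 3 ≤ n)
    (a : Fin n → ℝ)
    (hreg : ∀ k ℓ p q : Fin n, k ≠ ℓ → p ≠ q →
      a ℓ - a k = a q - a p → k = p ∧ ℓ = q)
    (H₀ H₁ : Matrix (Fin n) (Fin n) ℂ)
    (hH₀ : H₀ = Matrix.diagonal fun k => (a k : ℂ))
    (hH₁ : H₁.IsHermitian) (hH₁diag : ∀ k : Fin n, H₁ k k = 0)
    (hconn : ∀ k ℓ : Fin n, k ≠ ℓ → H₁ k ℓ ≠ 0)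
    (w u : ℝ) (hwu : w ≠ u)
    (ρd0 : Matrix (Fin n) (Fin n) ℂ)
    (hpos : ρd0.PosSemidef) (htr : Matrix.trace ρd0 = 1)
    (hpp : ∃ U ∈ Matrix.unitaryGroup (Fin n) ℂ,
      ρd0 = U * (Matrix.diagonal fun k => if k.val = 0 then (w : ℂ) else (u : ℂ)) * star U)
    (hexc : ¬ ∃ (k ℓ : Fin n) (α : ℝ), k < ℓ ∧
      ρd0 = Matrix.of fun i j =>
        if i = k ∧ j = k then (((w + u) / 2 : ℝ) : ℂ)
        else if i = ℓ ∧ j = ℓ then (((w + u) / 2 : ℝ) : ℂ)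
        else if i = k ∧ j = ℓ then (((w - u) / 2 : ℝ) : ℂ) * Complex.exp (Complex.I * α)
        else if i = ℓ ∧ j = k then (((w - u) / 2 : ℝ) : ℂ) * Complex.exp (-(Complex.I * α))
        else if i = j then (u : ℂ) else 0)
    (κ : ℝ) (hκ : 0 < κ)
    (ρ ρd : ℝ → Matrix (Fin n) (Fin n) ℂ)
    (f : ℝ → ℝ)
    (hf : ∀ t, f t =
      κ * (Matrix.trace (((-Complex.I) • (H₁ * ρ t - ρ t * H₁)) * ρd t)).re)
    (hρ : ∀ t, ∀ i j : Fin n, HasDerivAt (fun s => ρ s i j)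
      (((-Complex.I) • ((H₀ + (f t : ℂ) • H₁) * ρ t - ρ t * (H₀ + (f t : ℂ) • H₁))) i j) t)
    (hρd : ∀ t, ∀ i j : Fin n, HasDerivAt (fun s => ρd s i j)
      (((-Complex.I) • (H₀ * ρd t - ρd t * H₀)) i j) t)
    (hρd0 : ρd 0 = ρd0)
    (hρ0 : ∃ U ∈ Matrix.unitaryGroup (Fin n) ℂ, ρ 0 = U * ρd0 * star U)
    (Vmax : ℝ)
    (hVmax : IsGreatest
      {v : ℝ | ∃ ρ' : Matrix (Fin n) (Fin n) ℂ,
        (∃ U ∈ Matrix.unitaryGroup (Fin n) ℂ, ρ' = U * ρd0 * star U) ∧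
        v = (1 / 2 : ℝ) * (Matrix.trace ((ρ' - ρd0) ^ 2)).re} Vmax)
    (hinit : (1 / 2 : ℝ) * (Matrix.trace ((ρ 0 - ρd0) ^ 2)).re < Vmax) :
    Filter.Tendsto (fun t => ρ t - ρd t) Filter.atTop (nhds 0) := by
  subst hH₀ hρd0
  have hherm : (ρd 0).IsHermitian := hpos.isHermitian
  set P : ℝ → Matrix (Fin n) (Fin n) ℂ :=
    fun t => purePart w u (interactionPicture a t (ρ t)) with hPdef
  set Q := purePart w u (ρd 0) with hQdef
  have hQ : IsPureState Q := by
    obtain ⟨U, hU, h⟩ := hpp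
    rw [hQdef, h, purePart_unitary_conj hU]
    exact (isPureState_purePart_diagonal (by lia) hwu).unitary_conj hU
  have hconj : ∀ ρ' : Matrix (Fin n) (Fin n) ℂ,
      (∃ U ∈ Matrix.unitaryGroup (Fin n) ℂ, ρ' = U * ρd 0 * star U) →
      IsPureState (purePart w u ρ') := by
    rintro _ ⟨U, hU, rfl⟩
    rw [purePart_unitary_conj hU]
    exact hQ.unitary_conj hU
  have hP0 : P 0 = purePart w u (ρ 0) := by
    simp only [hPdef, interactionPicture.zero_time]
  have hoverlap : 0 < (P 0 * Q).trace.re := by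
    obtain ⟨ρ', hρ', hv⟩ := hVmax.1
    rw [hv, half_trace_sub_sq hwu (hconj _ hρ0) hQ, half_trace_sub_sq hwu (hconj _ hρ') hQ] at hinit
    have h1 := lt_of_mul_lt_mul_left hinit (sq_nonneg _)
    have h2 := (hconj _ hρ').trace_mul_re_nonneg hQ
    rw [hP0]
    linarith
  have htarget : ∀ t, interactionPicture a t (ρd t) = ρd 0 := fun t => by
    have hder : ∀ t, HasMatrixDerivAt (fun s => interactionPicture a s (ρd s)) 0 t := fun t => by
      have h := HasMatrixDerivAt.interactionPicture (a := a) (X := ρd) (A := 0) (t := t) (by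
        rw [add_zero]; exact hρd t)
      convert h using 1
      simp only [Matrix.zero_mul, Matrix.mul_zero, sub_zero, smul_zero]
      ext i j; simp [interactionPicture.apply]
    ext i j
    have := is_const_of_deriv_eq_zero (fun t => (hder t i j).differentiableAt)
      (fun t => (hder t i j).deriv) t 0
    simpa only [interactionPicture.zero_time] using this
  have hf' : ∀ t, f t = κ * (w - u) ^ 2 * (((-I) • (interactionPicture a t H₁ * P t -
      P t * interactionPicture a t H₁)) * Q).trace.re := fun t => by
    rw [hf t, ← interactionPicture.trace a t, interactionPicture.mul, interactionPicture.smul,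
      interactionPicture.sub, interactionPicture.mul, interactionPicture.mul, htarget,
      trace_commutator_purePart hwu, ← Complex.ofReal_pow, Complex.re_ofReal_mul, mul_assoc]
  have hP : ∀ t, HasMatrixDerivAt P ((-I) • (((f t : ℂ) • interactionPicture a t H₁) * P t -
      P t * ((f t : ℂ) • interactionPicture a t H₁))) t := fun t => by
    have h := (((HasMatrixDerivAt.interactionPicture (hρ t)).sub
      (HasMatrixDerivAt.const ((u : ℂ) • 1))).const_smul ((w - u : ℝ) : ℂ)⁻¹)
    rw [sub_zero, interactionPicture.smul, interactionPicture.sub, interactionPicture.mul,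
      interactionPicture.mul, interactionPicture.smul, smul_comm, ← commutator_purePart] at h
    exact h
  obtain ⟨hpure, hlim⟩ := tendsto_overlap_one hreg hH₁ hH₁diag hconn
    (mul_pos hκ (by have := sub_ne_zero.2 hwu; positivity)) (hP0 ▸ hconj _ hρ0) hQ hf' hP hoverlap
    (fun h => hexc (exceptional_form_of_equator hwu hherm h))
  refine tendsto_pi_nhds.2 fun i => tendsto_pi_nhds.2 fun j => ?_
  have hbound : Tendsto (fun t => ‖((w - u : ℝ) : ℂ)‖ *
      Real.sqrt (2 - 2 * (P t * Q).trace.re)) atTop (𝓝 0) := by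
    have h := ((hlim.const_mul 2).const_sub 2).sqrt.const_mul ‖((w - u : ℝ) : ℂ)‖
    simpa using h
  refine squeeze_zero_norm (fun t => ?_) hbound
  rw [← interactionPicture.norm_apply a t, interactionPicture.sub, htarget,
    sub_eq_smul_purePart_sub hwu, Matrix.smul_apply, norm_smul]
  gcongr
  exact Real.le_sqrt_of_sq_le ((hpure t).norm_sub_apply_sq_le hQ i j)
end

section
/- Let H₀ = diag(a₁,…,aₙ) be a real diagonal strongly regular n×n matrix, let H₁ be a fully connected n×n Hermitian matrix with zero diagonal, and let ρ_d = diag(w₁,…,wₙ) be a density matrix with pairwise distinct diagonal entries (a generic stationary target state). Let ρ : ℝ → Matrix (Fin n) (Fin n) ℂ be differentiable, satisfy ρ'(t) = −i[H₀ + f(t)·H₁, ρ(t)] with f(t) = κ·Re(Tr([−iH₁, ρ(t)]·ρ_d)), κ > 0, and suppose ρ(0) is unitarily equivalent to ρ_d. Then there exists a permutation σ of {1,…,n} such that ρ(t) → diag(w_{σ(1)},…,w_{σ(n)}) as t → +∞. -/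
open Matrix Complex
open scoped ComplexOrder

open Filter Topology Polynomial

/-- A form of Barbalat's lemma: if `g` converges and `g' = h + e` with `e → 0` and `h'` bounded,
then `h → 0`. -/
lemma tendsto_zero_of_hasDerivAt_add {E : Type*} [NormedAddCommGroup E] [NormedSpace ℝ E]
    {g h e h' : ℝ → E} {L : E} {C : ℝ} (hg : Tendsto g atTop (𝓝 L))
    (hg' : ∀ t, HasDerivAt g (h t + e t) t) (he : Tendsto e atTop (𝓝 0))
    (hh : ∀ t, HasDerivAt h (h' t) t) (hC : ∀ t, ‖h' t‖ ≤ C) :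
    Tendsto h atTop (𝓝 0) := by
  have hC0 : 0 ≤ C := (norm_nonneg _).trans (hC 0)
  rw [Metric.tendsto_atTop]
  intro ε hε
  set δ : ℝ := ε / (4 * (C + 1)) with hδ
  have hδ0 : 0 < δ := by positivity
  have hCδ : C * δ ≤ ε / 4 := by
    rw [hδ, ← mul_div_assoc, div_le_div_iff₀ (by positivity) (by norm_num)]
    nlinarith
  obtain ⟨T₁, hT₁⟩ := Metric.tendsto_atTop.1 hg (δ * ε / 8) (by positivity)
  obtain ⟨T₂, hT₂⟩ := Metric.tendsto_atTop.1 he (ε / 4) (by positivity)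
  refine ⟨max T₁ T₂, fun t ht => ?_⟩
  have ht₁ : T₁ ≤ t := (le_max_left _ _).trans ht
  have ht₂ : T₂ ≤ t := (le_max_right _ _).trans ht
  have hlip : ∀ s, t ≤ s → s ≤ t + δ → ‖h s - h t‖ ≤ ε / 4 := by
    intro s hs hs'
    have := convex_univ.norm_image_sub_le_of_norm_hasDerivWithin_le (f := h) (x := t) (y := s)
      (fun x _ => (hh x).hasDerivWithinAt) (fun x _ => hC x) trivial trivial
    refine this.trans (le_trans ?_ hCδ)
    rw [Real.norm_eq_abs, abs_of_nonneg (by linarith)]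
    gcongr
    linarith
  have hmv := (convex_Icc t (t + δ)).norm_image_sub_le_of_norm_hasDerivWithin_le
    (f := fun s => g s - s • h t) (f' := fun s => h s + e s - (1 : ℝ) • h t) (C := ε / 2)
    (x := t) (y := t + δ)
    (fun x _ => ((hg' x).sub ((hasDerivAt_id x).smul_const (h t))).hasDerivWithinAt)
    (fun x hx => by
      have h1 := hlip x hx.1 hx.2
      have h2 := hT₂ x (ht₂.trans hx.1)
      rw [dist_zero_right] at h2
      calc ‖h x + e x - (1 : ℝ) • h t‖ = ‖(h x - h t) + e x‖ := by rw [one_smul]; congr 1; abel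
        _ ≤ ‖h x - h t‖ + ‖e x‖ := norm_add_le _ _
        _ ≤ ε / 2 := by linarith)
    ⟨le_rfl, by linarith⟩ ⟨by linarith, le_rfl⟩
  have hgg : ‖g (t + δ) - g t‖ ≤ δ * ε / 4 := by
    rw [← dist_eq_norm]
    have h1 := hT₁ t ht₁
    have h2 := hT₁ (t + δ) (by linarith)
    have := dist_triangle_right (g (t + δ)) (g t) L
    linarith
  have hsm : ‖δ • h t‖ ≤ δ * ε / 4 + ε / 2 * δ := by
    calc ‖δ • h t‖ = ‖(g (t + δ) - g t) - ((g (t + δ) - (t + δ) • h t) - (g t - t • h t))‖ := by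
          congr 1; rw [add_smul]; abel
      _ ≤ _ := (norm_sub_le _ _).trans (add_le_add hgg (hmv.trans_eq (by
          rw [add_sub_cancel_left, Real.norm_eq_abs, abs_of_pos hδ0])))
  rw [norm_smul, Real.norm_eq_abs, abs_of_pos hδ0] at hsm
  rw [dist_zero_right]
  have : δ * ‖h t‖ < δ * ε := by nlinarith
  exact lt_of_mul_lt_mul_left this hδ0.le

/-- Asymptotically decoupled oscillators with distinct frequencies: if a linear combination of them
vanishes in the limit, then so does each one that occurs in it. -/
lemma tendsto_zero_of_sum_tendsto_zero {ι : Type*} [Fintype ι] {c ω : ι → ℂ}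
    (hω : ∀ i j, c i ≠ 0 → c j ≠ 0 → ω i = ω j → i = j) {r e : ι → ℝ → ℂ} {B K : ℝ}
    (hr : ∀ i t, HasDerivAt (r i) (ω i * r i t + e i t) t)
    (hB : ∀ i t, ‖r i t‖ ≤ B) (hK : ∀ i t, ‖e i t‖ ≤ K)
    (he : ∀ i, Tendsto (e i) atTop (𝓝 0))
    (hsum : Tendsto (fun t => ∑ i, c i * r i t) atTop (𝓝 0)) (i : ι) (hi : c i ≠ 0) :
    Tendsto (r i) atTop (𝓝 0) := by
  classical
  have hder : ∀ (d : ι → ℂ) (t : ℝ), HasDerivAt (fun t => ∑ i, d i * r i t)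
      (∑ i, d i * ω i * r i t + ∑ i, d i * e i t) t := by
    intro d t
    rw [← Finset.sum_add_distrib]
    refine (HasDerivAt.fun_sum fun i _ => (hr i t).const_mul (d i)).congr_deriv ?_
    exact Finset.sum_congr rfl fun i _ => by ring
  have herr : ∀ d : ι → ℂ, Tendsto (fun t => ∑ i, d i * e i t) atTop (𝓝 0) := by
    intro d
    simpa using tendsto_finsetSum Finset.univ fun i _ => (he i).const_mul (d i)
  have hstep : ∀ d : ι → ℂ, Tendsto (fun t => ∑ i, d i * r i t) atTop (𝓝 0) →
      Tendsto (fun t => ∑ i, d i * ω i * r i t) atTop (𝓝 0) := by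
    intro d hd
    refine tendsto_zero_of_hasDerivAt_add hd (hder d) (herr d) (hder fun i => d i * ω i)
      (C := ∑ i, ‖d i * ω i * ω i‖ * B + ∑ i, ‖d i * ω i‖ * K) fun t => ?_
    refine (norm_add_le _ _).trans (add_le_add ?_ ?_) <;>
    refine (norm_sum_le _ _).trans (Finset.sum_le_sum fun i _ => ?_) <;> rw [norm_mul]
    · exact mul_le_mul_of_nonneg_left (hB i t) (norm_nonneg _)
    · exact mul_le_mul_of_nonneg_left (hK i t) (norm_nonneg _)
  have hpoly : ∀ p : ℂ[X], Tendsto (fun t => ∑ i, c i * p.eval (ω i) * r i t) atTop (𝓝 0) := by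
    intro p
    induction p using Polynomial.induction_on' with
    | add p q hp hq => simpa [mul_add, add_mul, Finset.sum_add_distrib] using hp.add hq
    | monomial m z =>
      induction m with
      | zero => simpa [Finset.mul_sum, mul_assoc, mul_left_comm] using hsum.const_mul z
      | succ m ih =>
        simpa [pow_succ, mul_assoc] using hstep _ ih
  set p : ℂ[X] := ∏ j ∈ Finset.univ.filter (fun j => c j ≠ 0 ∧ j ≠ i), (X - C (ω j)) with hp
  have hpi : p.eval (ω i) ≠ 0 := by
    rw [hp, eval_prod, Finset.prod_ne_zero_iff]
    intro j hj
    rw [Finset.mem_filter] at hj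
    simpa [sub_eq_zero] using fun h => hj.2.2 (hω i j hi hj.2.1 h).symm
  have hpj : ∀ j, j ≠ i → c j * p.eval (ω j) = 0 := by
    intro j hj
    by_cases hc : c j = 0
    · rw [hc, zero_mul]
    · rw [hp, eval_prod, Finset.prod_eq_zero (i := j) (by simp [hc, hj]) (by simp), mul_zero]
  have hlim := (hpoly p).const_mul (c i * p.eval (ω i))⁻¹
  rw [mul_zero] at hlim
  refine hlim.congr fun t => ?_
  rw [Finset.sum_eq_single i (fun j _ hj => by rw [hpj j hj, zero_mul]) (by simp), ← mul_assoc,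
    inv_mul_cancel₀ (mul_ne_zero hi hpi), one_mul]

/-- A continuous real function along which a nonzero polynomial tends to zero converges to a root,
provided that it is bounded. -/
lemma exists_tendsto_isRoot {x : ℝ → ℝ} {p : ℝ[X]} (hx : Continuous x) (hp : p ≠ 0)
    {B : ℝ} (hB : ∀ t, |x t| ≤ B) (hlim : Tendsto (fun t => p.eval (x t)) atTop (𝓝 0)) :
    ∃ c, p.IsRoot c ∧ Tendsto x atTop (𝓝 c) := by
  have hconv : ∃ c, Tendsto x atTop (𝓝 c) := by
    refine tendsto_of_no_upcrossings (s := Set.univ) dense_univ ?_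
      (isBoundedUnder_of ⟨B, fun t => (abs_le.1 (hB t)).2⟩)
      (isBoundedUnder_of ⟨-B, fun t => (abs_le.1 (hB t)).1⟩)
    rintro a - b - hab ⟨ha, hb⟩
    obtain ⟨c, hc, hroot⟩ : ∃ c ∈ Set.Ioo a b, ¬ p.IsRoot c := by
      obtain ⟨c, hc, hr⟩ := (Set.Ioo_infinite hab).exists_notMem_finset p.roots.toFinset
      exact ⟨c, hc, fun h => hr (by simpa [hp] using h)⟩
    obtain ⟨T, hT⟩ := Metric.tendsto_atTop.1 hlim |p.eval c| (abs_pos.2 hroot)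
    obtain ⟨s, hs, hsa⟩ := frequently_atTop.1 ha T
    obtain ⟨u, hu, hub⟩ := frequently_atTop.1 hb T
    obtain ⟨v, hv, hvc⟩ := isPreconnected_Ici.intermediate_value (Set.mem_Ici.2 hs)
      (Set.mem_Ici.2 hu) hx.continuousOn ⟨hsa.le.trans hc.1.le, hc.2.le.trans hub.le⟩
    have := hT v hv
    rw [hvc, dist_zero_right] at this
    exact lt_irrefl _ this
  obtain ⟨c, hc⟩ := hconv
  exact ⟨c, tendsto_nhds_unique ((p.continuous.tendsto c).comp hc) hlim, hc⟩

section Commutator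

variable {n : Type*} [Fintype n]

/-- The curve `A` satisfies the von Neumann equation `A' = -i[H, A]` entrywise. -/
def IsVonNeumann (H A : ℝ → Matrix n n ℂ) : Prop :=
  ∀ t i j, HasDerivAt (fun s => A s i j) (((-Complex.I) • (H t * A t - A t * H t)) i j) t

lemma aeval_diagonal [DecidableEq n] (d : n → ℂ) (p : ℂ[X]) :
    aeval (Matrix.diagonal d) p = Matrix.diagonal fun k => p.eval (d k) := by
  have := aeval_algHom_apply (Matrix.diagonalAlgHom (n := n) (α := ℂ) ℂ) d p
  rw [Matrix.diagonalAlgHom_apply, Matrix.diagonalAlgHom_apply] at this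
  rw [this]
  congr 1
  funext k
  rw [aeval_fn_apply, ← coe_aeval_eq_eval]

lemma aeval_conj_unitary [DecidableEq n] {U : Matrix n n ℂ} (hU : U ∈ Matrix.unitaryGroup n ℂ)
    (D : Matrix n n ℂ) (p : ℂ[X]) : aeval (U * D * star U) p = U * aeval D p * star U := by
  have := aeval_algHom_apply (Unitary.conjStarAlgAut ℂ (Matrix n n ℂ) ⟨U, hU⟩) D p
  simpa [Unitary.conjStarAlgAut_apply] using this

lemma trace_commutator_mul_diagonal [DecidableEq n] (H A : Matrix n n ℂ) (d : n → ℂ) :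
    (((-I) • (H * A - A * H)) * Matrix.diagonal d).trace =
      ∑ p : n × n, -I * H p.2 p.1 * (d p.2 - d p.1) * A p.1 p.2 := by
  have h1 : (H * A * Matrix.diagonal d).trace = ∑ p : n × n, H p.2 p.1 * A p.1 p.2 * d p.2 := by
    rw [Fintype.sum_prod_type_right]
    simp only [Matrix.trace, Matrix.diag_apply, Matrix.mul_diagonal]
    simp only [Matrix.mul_apply, Finset.sum_mul]
  have h2 : (A * H * Matrix.diagonal d).trace = ∑ p : n × n, A p.1 p.2 * H p.2 p.1 * d p.1 := by
    rw [Fintype.sum_prod_type]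
    simp only [Matrix.trace, Matrix.diag_apply, Matrix.mul_diagonal]
    simp only [Matrix.mul_apply, Finset.sum_mul]
  rw [Matrix.smul_mul, Matrix.trace_smul, sub_mul, Matrix.trace_sub, h1, h2,
    ← Finset.sum_sub_distrib, smul_eq_mul, Finset.mul_sum]
  exact Finset.sum_congr rfl fun p _ => by ring

lemma ofReal_re_trace_commutator {H A D : Matrix n n ℂ} (hH : H.IsHermitian) (hA : A.IsHermitian)
    (hD : D.IsHermitian) : ((((-I) • (H * A - A * H)) * D).trace.re : ℂ) =
      (((-I) • (H * A - A * H)) * D).trace := by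
  have hX : ((-I) • (H * A - A * H)).IsHermitian := by
    rw [Matrix.IsHermitian, Matrix.conjTranspose_smul, Matrix.conjTranspose_sub,
      Matrix.conjTranspose_mul, Matrix.conjTranspose_mul, hH.eq, hA.eq, ← neg_sub, smul_neg,
      ← neg_smul]
    simp
  rw [← Complex.conj_eq_iff_re, starRingEnd_apply, ← Matrix.trace_conjTranspose,
    Matrix.conjTranspose_mul, hX.eq, hD.eq, Matrix.trace_mul_comm]

namespace IsVonNeumann

variable {H A B : ℝ → Matrix n n ℂ}

lemma add (hA : IsVonNeumann H A) (hB : IsVonNeumann H B) :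
    IsVonNeumann H fun t => A t + B t := by
  intro t i j
  refine ((hA t i j).add (hB t i j)).congr_deriv ?_
  rw [← Matrix.add_apply, ← smul_add]
  noncomm_ring

lemma const_smul (hA : IsVonNeumann H A) (z : ℂ) : IsVonNeumann H fun t => z • A t := by
  intro t i j
  refine ((hA t i j).const_mul z).congr_deriv ?_
  rw [← smul_eq_mul, ← Matrix.smul_apply, Matrix.mul_smul, Matrix.smul_mul, ← smul_sub,
    smul_comm z]

lemma one [DecidableEq n] : IsVonNeumann H fun _ => (1 : Matrix n n ℂ) := by
  intro t i j
  simpa using hasDerivAt_const t ((1 : Matrix n n ℂ) i j)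

lemma mul (hA : IsVonNeumann H A) (hB : IsVonNeumann H B) :
    IsVonNeumann H fun t => A t * B t := by
  intro t i j
  simp only [Matrix.mul_apply (M := A _)]
  refine (HasDerivAt.fun_sum fun k _ => (hA t i k).mul (hB t k j)).congr_deriv ?_
  rw [Finset.sum_add_distrib, ← Matrix.mul_apply, ← Matrix.mul_apply, ← Matrix.add_apply,
    Matrix.smul_mul, Matrix.mul_smul, ← smul_add]
  noncomm_ring

lemma conjTranspose (hA : IsVonNeumann H A) (hH : ∀ t, (H t).IsHermitian) :
    IsVonNeumann H fun t => (A t)ᴴ := by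
  intro t i j
  refine (hA t j i).star.congr_deriv ?_
  rw [← Matrix.conjTranspose_apply]
  rw [Matrix.conjTranspose_smul, Matrix.conjTranspose_sub, Matrix.conjTranspose_mul,
    Matrix.conjTranspose_mul, (hH t).eq, ← neg_sub, smul_neg, ← neg_smul]
  simp

lemma aeval [DecidableEq n] (hA : IsVonNeumann H A) (p : ℂ[X]) : IsVonNeumann H fun t => aeval (A t) p := by
  induction p using Polynomial.induction_on' with
  | add p q hp hq => simpa using hp.add hq
  | monomial m z =>
    have hpow : IsVonNeumann H fun t => A t ^ m := by
      induction m with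
      | zero => simpa using one
      | succ m ih => simpa only [pow_succ] using ih.mul hA
    simpa [aeval_monomial, Algebra.algebraMap_eq_smul_one] using hpow.const_smul z

lemma trace_eq (hA : IsVonNeumann H A) (t : ℝ) : (A t).trace = (A 0).trace := by
  have hder : ∀ s, HasDerivAt (fun s => (A s).trace) 0 s := by
    intro s
    refine (HasDerivAt.fun_sum fun i _ => hA s i i).congr_deriv ?_
    change Matrix.trace _ = 0
    rw [Matrix.trace_smul, Matrix.trace_sub, Matrix.trace_mul_comm, sub_self, smul_zero]
  exact is_const_of_deriv_eq_zero (fun s => (hder s).differentiableAt) (fun s => (hder s).deriv) t 0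

lemma eq_zero (hA : IsVonNeumann H A) (hH : ∀ t, (H t).IsHermitian) (h0 : A 0 = 0) (t : ℝ) :
    A t = 0 := by
  rw [← Matrix.trace_conjTranspose_mul_self_eq_zero_iff, ((hA.conjTranspose hH).mul hA).trace_eq t,
    h0]
  simp

lemma isHermitian (hA : IsVonNeumann H A) (hH : ∀ t, (H t).IsHermitian) (h0 : (A 0).IsHermitian)
    (t : ℝ) : (A t).IsHermitian := by
  have := ((hA.conjTranspose hH).add (hA.const_smul (-1))).eq_zero hH (by simp [h0.eq]) t
  rwa [neg_one_smul, ← sub_eq_add_neg, sub_eq_zero] at this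

lemma exists_norm_le (hA : IsVonNeumann H A) (hH : ∀ t, (H t).IsHermitian) :
    ∃ B : ℝ, ∀ t i j, ‖A t i j‖ ≤ B := by
  refine ⟨√(((A 0)ᴴ * A 0).trace).re, fun t i j => Real.le_sqrt_of_sq_le ?_⟩
  rw [← ((hA.conjTranspose hH).mul hA).trace_eq t]
  have : ((A t)ᴴ * A t).trace.re = ∑ k, ∑ l, ‖A t l k‖ ^ 2 := by
    simp only [Matrix.trace, Matrix.diag_apply, Matrix.mul_apply, Matrix.conjTranspose_apply,
      Complex.re_sum]
    refine Finset.sum_congr rfl fun k _ => Finset.sum_congr rfl fun l _ => ?_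
    rw [← Complex.normSq_eq_norm_sq, Complex.star_def, ← Complex.normSq_eq_conj_mul_self,
      Complex.ofReal_re]
  rw [this]
  refine le_trans ?_ (Finset.single_le_sum (f := fun k => ∑ l, ‖A t l k‖ ^ 2)
    (fun k _ => by positivity) (Finset.mem_univ j))
  exact Finset.single_le_sum (f := fun l => ‖A t l j‖ ^ 2)
    (fun k _ => by positivity) (Finset.mem_univ i)

lemma continuous_apply (hA : IsVonNeumann H A) (i j : n) : Continuous fun t => A t i j :=
  continuous_iff_continuousAt.2 fun t => (hA t i j).continuousAt

/-- A solution of the von Neumann equation starting unitarily equivalent to a diagonal matrix, whose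
off-diagonal entries vanish in the limit, converges to a permutation of that matrix. -/
lemma exists_tendsto_diagonal [DecidableEq n] (hA : IsVonNeumann H A)
    (hH : ∀ t, (H t).IsHermitian) {w : n → ℝ} (hw : Function.Injective w)
    {U : Matrix n n ℂ} (hU : U ∈ Matrix.unitaryGroup n ℂ)
    (h0 : A 0 = U * Matrix.diagonal (fun k => (w k : ℂ)) * star U)
    (hoff : ∀ i j, i ≠ j → Tendsto (fun t => A t i j) atTop (𝓝 0)) :
    ∃ σ : Equiv.Perm n, Tendsto A atTop (𝓝 (Matrix.diagonal fun k => (w (σ k) : ℂ))) := by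
  have hUU : star U * U = 1 := Matrix.mem_unitaryGroup_iff'.1 hU
  have haeval0 : ∀ p : ℂ[X], Polynomial.aeval (A 0) p =
      U * Matrix.diagonal (fun k => p.eval (w k : ℂ)) * star U := by
    intro p
    have := aeval_conj_unitary hU (Matrix.diagonal fun k => (w k : ℂ)) p
    rw [h0, this, aeval_diagonal]
  have hherm := hA.isHermitian hH (by
    rw [h0, Matrix.star_eq_conjTranspose]
    refine Matrix.isHermitian_mul_mul_conjTranspose _ ?_
    rw [Matrix.isHermitian_diagonal_iff]
    exact fun k => Complex.conj_ofReal _)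
  have htrace : ∀ (p : ℂ[X]) t, (Polynomial.aeval (A t) p).trace = ∑ k, p.eval (w k : ℂ) := by
    intro p t
    rw [(hA.aeval p).trace_eq t, haeval0, Matrix.trace_mul_comm, ← mul_assoc, hUU, one_mul,
      Matrix.trace_diagonal]
  obtain ⟨B, hB⟩ := hA.exists_norm_le hH
  have hreal : ∀ t i, ((A t i i).re : ℂ) = A t i i := fun t i =>
    Complex.conj_eq_iff_re.1 ((hherm t).apply i i)
  set q : ℝ[X] := ∏ k, (X - C (w k)) with hq
  have hqw : ∀ k, q.eval (w k) = 0 := fun k => by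
    rw [hq, eval_prod, Finset.prod_eq_zero (Finset.mem_univ k) (by simp)]
  have hq0 : ∀ t, Polynomial.aeval (A t) (q.map (algebraMap ℝ ℂ)) = 0 := by
    refine (hA.aeval _).eq_zero hH ?_
    have : (fun k => (q.map (algebraMap ℝ ℂ)).eval (w k : ℂ)) = fun _ => 0 := by
      funext k
      have := eval_map_apply (algebraMap ℝ ℂ) (p := q) (w k)
      simpa [hqw] using this
    rw [haeval0, this]
    simp
  have hlim : ∀ i, Tendsto (fun t => q.eval (A t i i).re) atTop (𝓝 0) := by
    intro i
    rw [tendsto_iff_ultrafilter]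
    intro u hu
    have hcpt : IsCompact (Set.univ.pi fun _ : n => Set.univ.pi fun _ : n =>
        Metric.closedBall (0 : ℂ) B) :=
      isCompact_univ_pi fun _ => isCompact_univ_pi fun _ => isCompact_closedBall _ _
    obtain ⟨M, hM⟩ : ∃ M : Matrix n n ℂ, Tendsto A u (𝓝 M) := by
      obtain ⟨M, -, hM⟩ := hcpt.ultrafilter_le_nhds' (u.map A)
        (Filter.mem_map.2 (Filter.univ_mem' fun t i _ j _ => by simpa using hB t i j))
      exact ⟨M, hM⟩
    have hMij : ∀ i j, Tendsto (fun t => A t i j) u (𝓝 (M i j)) := fun i j =>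
      ((Continuous.matrix_elem continuous_id i j).tendsto _).comp hM
    have hdiag : M = Matrix.diagonal fun k => M k k := by
      ext k l
      by_cases hkl : k = l
      · subst hkl; simp
      · rw [Matrix.diagonal_apply_ne _ hkl]
        exact tendsto_nhds_unique (hMij k l) ((hoff k l hkl).mono_left hu)
    have hMq : Polynomial.aeval (M : Matrix n n ℂ) (q.map (algebraMap ℝ ℂ)) = 0 := by
      refine tendsto_nhds_unique
        (((q.map (algebraMap ℝ ℂ)).continuous_aeval.tendsto _).comp hM) ?_
      exact tendsto_const_nhds.congr fun t => (hq0 t).symm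
    have hre : Tendsto (fun t => (A t i i).re) u (𝓝 (M i i).re) :=
      (Complex.continuous_re.tendsto _).comp (hMij i i)
    have hMre : ((M i i).re : ℂ) = M i i := by
      refine tendsto_nhds_unique ((Complex.continuous_ofReal.tendsto _).comp hre) ?_
      exact (hMij i i).congr fun t => (hreal t i).symm
    have hroot : q.eval (M i i).re = 0 := by
      rw [hdiag, aeval_diagonal] at hMq
      have h1 := congr_fun (congr_fun hMq i) i
      have h2 := eval_map_apply (algebraMap ℝ ℂ) (p := q) (M i i).re
      rw [Matrix.diagonal_apply_eq, ← hMre] at h1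
      simpa using h2.symm.trans h1
    have := (q.continuous.tendsto (M i i).re).comp hre
    rwa [hroot] at this
  have hconv : ∀ i, ∃ k, Tendsto (fun t => A t i i) atTop (𝓝 (w k : ℂ)) := by
    intro i
    obtain ⟨c, hc, hlc⟩ := exists_tendsto_isRoot
      (Complex.continuous_re.comp (hA.continuous_apply i i))
      (Finset.prod_ne_zero_iff.2 fun k _ => X_sub_C_ne_zero (w k))
      (fun t => (Complex.abs_re_le_norm _).trans (hB t i i)) (hlim i)
    obtain ⟨k, hk⟩ : ∃ k, c = w k := by
      rw [IsRoot, eval_prod, Finset.prod_eq_zero_iff] at hc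
      obtain ⟨k, -, hk⟩ := hc
      exact ⟨k, by simpa [sub_eq_zero] using hk⟩
    subst hk
    exact ⟨k, ((Complex.continuous_ofReal.tendsto _).comp hlc).congr fun t => hreal t i⟩
  choose τ hτ using hconv
  have hAlim : Tendsto A atTop (𝓝 (Matrix.diagonal fun k => (w (τ k) : ℂ))) := by
    refine tendsto_pi_nhds.2 fun i => tendsto_pi_nhds.2 fun j => ?_
    by_cases hij : i = j
    · subst hij
      simpa using hτ i
    · rw [Matrix.diagonal_apply_ne _ hij]
      exact hoff i j hij
  have hsurj : Function.Surjective τ := by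
    intro j
    by_contra! hj
    set p : ℂ[X] := ∏ k ∈ Finset.univ.erase j, (X - C (w k : ℂ)) with hp
    have hpk : ∀ k, k ≠ j → p.eval (w k : ℂ) = 0 := fun k hk => by
      rw [hp, eval_prod, Finset.prod_eq_zero (i := k) (by simp [hk]) (by simp)]
    have hpj : p.eval (w j : ℂ) ≠ 0 := by
      rw [hp, eval_prod, Finset.prod_ne_zero_iff]
      intro k hk
      simpa [sub_eq_zero] using fun h => (Finset.ne_of_mem_erase hk) (hw h).symm
    have h1 : Tendsto (fun t => (Polynomial.aeval (A t) p).trace) atTop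
        (𝓝 (Polynomial.aeval (Matrix.diagonal fun k => (w (τ k) : ℂ)) p).trace) :=
      ((p.continuous_aeval.matrix_trace).tendsto _).comp hAlim
    have h2 := tendsto_nhds_unique h1 (tendsto_const_nhds.congr fun t => (htrace p t).symm)
    rw [aeval_diagonal, Matrix.trace_diagonal, Finset.sum_eq_zero fun k _ => hpk _ (hj k),
      Finset.sum_eq_single j (fun k _ hk => hpk k hk) (by simp)] at h2
    exact hpj h2.symm
  exact ⟨Equiv.ofBijective τ (Finite.surjective_iff_bijective.1 hsurj), hAlim⟩

end IsVonNeumann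

end Commutator

/-- (Convergence for generic stationary target states of ideal systems.)
For `H₀` strongly regular real diagonal, `H₁` fully connected Hermitian with zero
diagonal, and a generic stationary target `ρ_d = diag(w₁,…,wₙ)` (a density matrix
with pairwise distinct diagonal entries), every solution of the Lyapunov-controlled
system starting unitarily equivalent to `ρ_d` converges to some permutation
`diag(w_{σ(1)},…,w_{σ(n)})` of the target as `t → +∞`. -/
theorem stmt17 {n : ℕ}
    (a : Fin n → ℝ)
    (hreg : ∀ k ℓ p q : Fin n, k ≠ ℓ → p ≠ q →
      a ℓ - a k = a q - a p → k = p ∧ ℓ = q)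
    (H₀ H₁ : Matrix (Fin n) (Fin n) ℂ)
    (hH₀ : H₀ = Matrix.diagonal fun k => (a k : ℂ))
    (hH₁ : H₁.IsHermitian) (hH₁diag : ∀ k : Fin n, H₁ k k = 0)
    (hconn : ∀ k ℓ : Fin n, k ≠ ℓ → H₁ k ℓ ≠ 0)
    (w : Fin n → ℝ) (hw : Function.Injective w)
    (ρd : Matrix (Fin n) (Fin n) ℂ)
    (hρd : ρd = Matrix.diagonal fun k => (w k : ℂ))
    (hpos : ρd.PosSemidef) (htr : Matrix.trace ρd = 1)
    (κ : ℝ) (hκ : 0 < κ)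
    (ρ : ℝ → Matrix (Fin n) (Fin n) ℂ)
    (f : ℝ → ℝ)
    (hf : ∀ t, f t =
      κ * (Matrix.trace (((-Complex.I) • (H₁ * ρ t - ρ t * H₁)) * ρd)).re)
    (hρ : ∀ t, ∀ i j : Fin n, HasDerivAt (fun s => ρ s i j)
      (((-Complex.I) • ((H₀ + (f t : ℂ) • H₁) * ρ t - ρ t * (H₀ + (f t : ℂ) • H₁))) i j) t)
    (hρ0 : ∃ U ∈ Matrix.unitaryGroup (Fin n) ℂ, ρ 0 = U * ρd * star U) :
    ∃ σ : Equiv.Perm (Fin n),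
      Filter.Tendsto ρ Filter.atTop
        (nhds (Matrix.diagonal fun k => (w (σ k) : ℂ))) := by
  have hHerm : ∀ t, (H₀ + (f t : ℂ) • H₁).IsHermitian := by
    intro t
    refine Matrix.IsHermitian.add ?_ (hH₁.smul (Complex.conj_ofReal _))
    rw [hH₀, Matrix.isHermitian_diagonal_iff]
    exact fun k => Complex.conj_ofReal _
  have hvN : IsVonNeumann (fun t => H₀ + (f t : ℂ) • H₁) ρ := hρ
  obtain ⟨U, hU, h0⟩ := hρ0
  rw [hρd] at h0
  have hρdH : ρd.IsHermitian := hpos.isHermitian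
  have hherm : ∀ t, (ρ t).IsHermitian := hvN.isHermitian hHerm (by
    rw [h0, ← hρd, Matrix.star_eq_conjTranspose]
    exact Matrix.isHermitian_mul_mul_conjTranspose _ hρdH)
  obtain ⟨B, hB⟩ := hvN.exists_norm_le hHerm
  -- The control is a linear combination of the coherences.
  set c : Fin n × Fin n → ℂ := fun p => κ * (-I * H₁ p.2 p.1 * (w p.2 - w p.1)) with hc
  have hfsum : ∀ t, (f t : ℂ) = ∑ p, c p * ρ t p.1 p.2 := by
    intro t
    rw [hf t, Complex.ofReal_mul, ofReal_re_trace_commutator hH₁ (hherm t) hρdH, hρd,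
      trace_commutator_mul_diagonal, Finset.mul_sum, hc]
    exact Finset.sum_congr rfl fun p _ => by push_cast; ring
  set ω : Fin n × Fin n → ℂ := fun p => -I * (a p.1 - a p.2) with hω
  set E : Fin n × Fin n → ℝ → ℂ := fun p t => (-I • (H₁ * ρ t - ρ t * H₁)) p.1 p.2 with hE
  have hder : ∀ p t, HasDerivAt (fun s => ρ s p.1 p.2) (ω p * ρ t p.1 p.2 + f t * E p t) t := by
    intro p t
    refine (hρ t p.1 p.2).congr_deriv ?_
    simp only [hH₀, hω, hE, add_mul, mul_add, Matrix.smul_mul, Matrix.mul_smul, Matrix.smul_apply,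
      Matrix.sub_apply, Matrix.add_apply, Matrix.diagonal_mul, Matrix.mul_diagonal, smul_eq_mul]
    ring
  have hKp : ∀ p, ∃ K, ∀ t, ‖E p t‖ ≤ K := by
    intro p
    refine ⟨∑ j, ‖H₁ p.1 j‖ * B + ∑ j, B * ‖H₁ j p.2‖, fun t => ?_⟩
    simp only [hE, Matrix.smul_apply, norm_smul, norm_neg, Complex.norm_I, one_mul,
      Matrix.sub_apply, Matrix.mul_apply]
    refine (norm_sub_le _ _).trans (add_le_add ?_ ?_) <;>
    refine (norm_sum_le _ _).trans (Finset.sum_le_sum fun j _ => ?_) <;> rw [norm_mul]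
    · exact mul_le_mul_of_nonneg_left (hB _ _ _) (norm_nonneg _)
    · exact mul_le_mul_of_nonneg_right (hB _ _ _) (norm_nonneg _)
  choose K hK using hKp
  obtain ⟨F, hF⟩ : ∃ F, ∀ t, ‖(f t : ℂ)‖ ≤ F := by
    refine ⟨∑ p, ‖c p‖ * B, fun t => ?_⟩
    rw [hfsum t]
    refine (norm_sum_le _ _).trans (Finset.sum_le_sum fun p _ => ?_)
    rw [norm_mul]
    exact mul_le_mul_of_nonneg_left (hB _ _ _) (norm_nonneg _)
  have hF0 : 0 ≤ F := (norm_nonneg _).trans (hF 0)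
  have hfE : ∀ p t, ‖(f t : ℂ) * E p t‖ ≤ F * K p := fun p t => by
    rw [norm_mul]
    exact mul_le_mul (hF t) (hK p t) (norm_nonneg _) hF0
  -- The control has a bounded derivative.
  set f' : ℝ → ℂ := fun t => ∑ p, c p * (ω p * ρ t p.1 p.2 + f t * E p t) with hf'
  have hfder : ∀ t, HasDerivAt f (f' t).re t := by
    intro t
    have h1 : HasDerivAt (fun s => ∑ p, c p * ρ s p.1 p.2) (f' t) t :=
      HasDerivAt.fun_sum fun p _ => (hder p t).const_mul (c p)
    refine (Complex.reCLM.hasFDerivAt.comp_hasDerivAt t h1).congr_of_eventuallyEq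
      (Eventually.of_forall fun s => ?_)
    simp [← hfsum s]
  obtain ⟨F', hF'⟩ : ∃ F', ∀ t, |(f' t).re| ≤ F' := by
    refine ⟨∑ p, ‖c p‖ * (‖ω p‖ * B + F * K p), fun t => ?_⟩
    refine (Complex.abs_re_le_norm _).trans
      ((norm_sum_le _ _).trans (Finset.sum_le_sum fun p _ => ?_))
    rw [norm_mul]
    refine mul_le_mul_of_nonneg_left ((norm_add_le _ _).trans (add_le_add ?_ (hfE p t)))
      (norm_nonneg _)
    rw [norm_mul]
    exact mul_le_mul_of_nonneg_left (hB _ _ _) (norm_nonneg _)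
  -- The Lyapunov function.
  set V : ℝ → ℝ := fun t => ∑ k, w k * (ρ t k k).re with hV
  have hVder : ∀ t, HasDerivAt V (f t ^ 2 / κ + 0) t := by
    intro t
    have h1 : ∀ k, HasDerivAt (fun s => (ρ s k k).re) ((f t : ℂ) * E (k, k) t).re t := by
      intro k
      refine (Complex.reCLM.hasFDerivAt.comp_hasDerivAt t (hder (k, k) t)).congr_deriv ?_
      simp [hω]
    refine (HasDerivAt.fun_sum fun k _ => (h1 k).const_mul (w k)).congr_deriv ?_
    have h2 : f t = κ * ∑ k, w k * (E (k, k) t).re := by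
      rw [hf t, hρd, Matrix.trace, Complex.re_sum]
      congr 1
      refine Finset.sum_congr rfl fun k _ => ?_
      rw [Matrix.diag_apply, Matrix.mul_diagonal, Complex.re_mul_ofReal, mul_comm]
    have h3 : ∑ k, w k * (E (k, k) t).re = f t / κ := by
      rw [h2, mul_div_cancel_left₀ _ hκ.ne']
    calc ∑ k, w k * ((f t : ℂ) * E (k, k) t).re
        = f t * ∑ k, w k * (E (k, k) t).re := by
          rw [Finset.mul_sum]
          exact Finset.sum_congr rfl fun k _ => by rw [Complex.re_ofReal_mul]; ring
      _ = f t ^ 2 / κ + 0 := by rw [h3]; ring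
  have hVmono : Monotone V := monotone_of_hasDerivAt_nonneg hVder fun t => by
    simp only [add_zero]; positivity
  have hVbdd : BddAbove (Set.range V) := by
    refine ⟨∑ k, |w k| * B, ?_⟩
    rintro _ ⟨t, rfl⟩
    refine Finset.sum_le_sum fun k _ => (le_abs_self _).trans ?_
    rw [abs_mul]
    exact mul_le_mul_of_nonneg_left ((Complex.abs_re_le_norm _).trans (hB _ _ _)) (abs_nonneg _)
  have hfsq : Tendsto (fun t => f t ^ 2 / κ) atTop (𝓝 0) := by
    refine tendsto_zero_of_hasDerivAt_add (tendsto_atTop_ciSup hVmono hVbdd) hVder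
      tendsto_const_nhds (fun t => ((hfder t).pow 2).div_const κ) (C := 2 * F * F' / κ) fun t => ?_
    have h1 : |f t| ≤ F := by simpa using hF t
    simp only [Nat.cast_ofNat, Nat.add_one_sub_one, pow_one, Real.norm_eq_abs, abs_div, abs_mul,
      abs_two, abs_of_pos hκ]
    gcongr
    exact hF' t
  have hflim : Tendsto (fun t => (f t : ℂ)) atTop (𝓝 0) := by
    have h1 : Tendsto (fun t => f t ^ 2) atTop (𝓝 0) := by
      simpa [div_mul_cancel₀ _ hκ.ne'] using hfsq.mul_const κ
    have h2 : Tendsto f atTop (𝓝 0) := by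
      rw [tendsto_zero_iff_abs_tendsto_zero]
      simpa [Function.comp_def, Real.sqrt_sq_eq_abs] using h1.sqrt
    simpa [Function.comp_def] using (Complex.continuous_ofReal.tendsto 0).comp h2
  have hc0 : ∀ p, c p ≠ 0 ↔ p.1 ≠ p.2 := by
    intro p
    constructor
    · intro h hp
      exact h (by simp [hc, hp])
    · intro h
      have h1 : (w p.2 : ℂ) - w p.1 ≠ 0 :=
        sub_ne_zero.2 fun h' => h (hw (Complex.ofReal_injective h')).symm
      exact mul_ne_zero (Complex.ofReal_ne_zero.2 hκ.ne')
        (mul_ne_zero (mul_ne_zero (neg_ne_zero.2 I_ne_zero) (hconn _ _ h.symm)) h1)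
  obtain ⟨K', hK'⟩ := (Set.finite_range fun p => F * K p).bddAbove
  rw [mem_upperBounds, Set.forall_mem_range] at hK'
  refine hvN.exists_tendsto_diagonal hHerm hw hU h0 fun i j hij => ?_
  refine tendsto_zero_of_sum_tendsto_zero (c := c) (ω := ω) (r := fun p t => ρ t p.1 p.2)
    (e := fun p t => f t * E p t) ?_ hder (fun p t => hB t _ _)
    (fun p t => (hfE p t).trans (hK' p)) (fun p => ?_) (hflim.congr hfsum) (i, j) ((hc0 _).2 hij)
  · intro p q hp hq hpq
    have h1 := mul_left_cancel₀ (neg_ne_zero.2 I_ne_zero) hpq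
    obtain ⟨h2, h3⟩ := hreg p.2 p.1 q.2 q.1 ((hc0 p).1 hp).symm ((hc0 q).1 hq).symm
      (by exact_mod_cast h1)
    exact Prod.ext h3 h2
  · exact hflim.zero_mul_isBoundedUnder_le (isBoundedUnder_of ⟨K p, hK p⟩)
end
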